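/- arXiv:1108.5129 — 2 statements merged into one kernel-verified Lean document; each statement's English description precedes it below -/
import Mathlib

section
/- For every dimension d ≥ 1 there exists a constant C_d' > 0, depending only on d, such that for every cube Q ⊂ ℝ^d with volume |Q|, every N ≥ 1, and all smooth functions φ₁,…,φ_N : ℝ^d → ℂ with ∫_Q ρ > 0, where ρ(x) := ∑_{j=1}^N |φ_j(x)|²: ∑_{j=1}^N ∫_Q |∇φ_j|² dx ≥ C_d' · (∫_Q ρ)^{−2/d} · ∫_Q [ρ(x)^{1/2} − ((∫_Q ρ)/|Q|)^{1/2}]₊^{2(d+2)/d} dx. -/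
open MeasureTheory

noncomputable section

/-- A cube in `ℝ^d`: a set congruent to `(0,L)^d` for some `L > 0`. -/
def IsCube (d : ℕ) (Q : Set (EuclideanSpace ℝ (Fin d))) : Prop :=
  ∃ L : ℝ, 0 < L ∧ ∃ f : EuclideanSpace ℝ (Fin d) ≃ᵢ EuclideanSpace ℝ (Fin d),
    Q = f '' {x : EuclideanSpace ℝ (Fin d) | ∀ m, x m ∈ Set.Ioo 0 L}

/-- The Cauchy–Schwarz inequality against the constant function on a probability space. -/
lemma sq_lintegral_le_lintegral_sq {α : Type*} [MeasurableSpace α] {μ : Measure α}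
    [IsProbabilityMeasure μ] {h : α → ENNReal} (hh : AEMeasurable h μ) :
    (∫⁻ t, h t ∂μ) ^ 2 ≤ ∫⁻ t, h t ^ 2 ∂μ := by
  have key := ENNReal.lintegral_mul_le_Lp_mul_Lq μ Real.HolderConjugate.two_two hh
    (aemeasurable_const (b := (1 : ENNReal)))
  simp only [Pi.mul_apply, mul_one, lintegral_const, measure_univ, ENNReal.rpow_ofNat, one_pow,
    ENNReal.one_rpow] at key
  calc (∫⁻ t, h t ∂μ) ^ 2 ≤ ((∫⁻ t, h t ^ 2 ∂μ) ^ (1 / 2 : ℝ)) ^ 2 := by gcongr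
    _ = ∫⁻ t, h t ^ 2 ∂μ := by
        rw [← ENNReal.rpow_natCast, ← ENNReal.rpow_mul]; norm_num

section Poincare

variable {E : Type*} [NormedAddCommGroup E] [NormedSpace ℝ E]
  {F : Type*} [NormedAddCommGroup F] [NormedSpace ℝ F]

/-- The squared increment of a `C¹` function is controlled by its derivative along the segment. -/
lemma enorm_sub_sq_le_lintegral_fderiv [CompleteSpace F] {f : E → F} (hf : ContDiff ℝ 1 f)
    (x y : E) :
    ‖f x - f y‖ₑ ^ 2 ≤
      ‖x - y‖ₑ ^ 2 * ∫⁻ t in Set.Ioc (0 : ℝ) 1, ‖fderiv ℝ f (y + t • (x - y))‖ₑ ^ 2 := by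
  have hcont : Continuous fun t : ℝ => fderiv ℝ f (y + t • (x - y)) :=
    (hf.continuous_fderiv one_ne_zero).comp (by fun_prop)
  have hd : ∀ t : ℝ, HasDerivAt (fun s : ℝ => f (y + s • (x - y)))
      (fderiv ℝ f (y + t • (x - y)) (x - y)) t := by
    intro t
    have h1 : HasDerivAt (fun s : ℝ => y + s • (x - y)) (x - y) t := by
      simpa using ((hasDerivAt_id t).smul_const (x - y)).const_add y
    exact ((hf.differentiable one_ne_zero _).hasFDerivAt).comp_hasDerivAt t h1
  have hftc := intervalIntegral.integral_eq_sub_of_hasDerivAt (a := 0) (b := 1)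
    (fun t _ => hd t) ((hcont.clm_apply continuous_const).intervalIntegrable _ _)
  simp only [one_smul, add_sub_cancel, zero_smul, add_zero] at hftc
  rw [intervalIntegral.integral_of_le zero_le_one] at hftc
  have : IsProbabilityMeasure (volume.restrict (Set.Ioc (0 : ℝ) 1)) := ⟨by simp⟩
  calc ‖f x - f y‖ₑ ^ 2
      ≤ (∫⁻ t in Set.Ioc (0 : ℝ) 1, ‖x - y‖ₑ * ‖fderiv ℝ f (y + t • (x - y))‖ₑ) ^ 2 := by
        rw [← hftc]
        gcongr
        refine (enorm_integral_le_lintegral_enorm _).trans (lintegral_mono fun t => ?_)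
        rw [mul_comm]
        exact ContinuousLinearMap.le_opENorm _ _
    _ = ‖x - y‖ₑ ^ 2 * (∫⁻ t in Set.Ioc (0 : ℝ) 1, ‖fderiv ℝ f (y + t • (x - y))‖ₑ) ^ 2 := by
        rw [lintegral_const_mul' _ _ enorm_ne_top, mul_pow]
    _ ≤ _ := by
        gcongr
        exact sq_lintegral_le_lintegral_sq hcont.enorm.measurable.aemeasurable

variable [MeasurableSpace E] [BorelSpace E] [FiniteDimensional ℝ E]

/-- Contracting a convex set towards one of its points by a factor at least `1/2` increases
integrals at most by the factor `2 ^ dim`. -/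
lemma setLIntegral_homothety_le (μ : Measure E) [μ.IsAddHaarMeasure] {S : Set E}
    (hS : Convex ℝ S) (hSm : MeasurableSet S) {G : E → ENNReal} (hG : Measurable G)
    {y : E} (hy : y ∈ S) {t : ℝ} (ht : 1 / 2 ≤ t) (ht1 : t ≤ 1) :
    ∫⁻ x in S, G (y + t • (x - y)) ∂μ ≤ 2 ^ Module.finrank ℝ E * ∫⁻ x in S, G x ∂μ := by
  have ht0 : 0 < t := by linarith
  have hGS : Measurable (S.indicator G) := hG.indicator hSm
  calc ∫⁻ x in S, G (y + t • (x - y)) ∂μ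
      ≤ ∫⁻ x, S.indicator G (t • x + (y - t • y)) ∂μ := by
        rw [← lintegral_indicator hSm]
        refine lintegral_mono fun x => ?_
        by_cases hx : x ∈ S
        · have hmem : t • x + (y - t • y) ∈ S := by
            have := hS hx hy ht0.le (sub_nonneg.2 ht1) (by ring)
            convert this using 1
            module
          rw [Set.indicator_of_mem hx, Set.indicator_of_mem hmem]
          refine le_of_eq (congrArg G ?_)
          module
        · rw [Set.indicator_of_notMem hx]; exact zero_le
    _ = ENNReal.ofReal |(t ^ Module.finrank ℝ E)⁻¹| * ∫⁻ x in S, G x ∂μ := by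
        have hm : Measurable fun z : E => S.indicator G (z + (y - t • y)) :=
          hGS.comp (measurable_id.add_const _)
        rw [← lintegral_map (μ := μ) hm (measurable_const_smul t),
          Measure.map_addHaar_smul μ ht0.ne',
          lintegral_smul_measure, lintegral_add_right_eq_self, lintegral_indicator hSm, smul_eq_mul]
    _ ≤ 2 ^ Module.finrank ℝ E * ∫⁻ x in S, G x ∂μ := by
        gcongr
        rw [abs_of_pos (by positivity), ← inv_pow, ENNReal.ofReal_pow (by positivity)]
        gcongr
        rw [← ENNReal.ofReal_ofNat]
        refine ENNReal.ofReal_le_ofReal ?_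
        rw [inv_le_comm₀ ht0 two_pos]
        linarith

lemma lintegral_segment_swap (μ : Measure E) [SFinite μ] (S : Set E) {G : E → ENNReal}
    (hGc : Continuous G) {c : ENNReal} :
    ∫⁻ x in S, ∫⁻ y in S, c * (∫⁻ t in Set.Ioc (0 : ℝ) 1, G (y + t • (x - y))) ∂μ ∂μ =
      c * ∫⁻ t in Set.Ioc (0 : ℝ) 1, ∫⁻ x in S, ∫⁻ y in S, G (y + t • (x - y)) ∂μ ∂μ := by
  have hm3 : Measurable fun p : (E × ℝ) × E => G (p.2 + p.1.2 • (p.1.1 - p.2)) :=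
    (hGc.comp (f := fun p : (E × ℝ) × E => p.2 + p.1.2 • (p.1.1 - p.2))
      (by fun_prop)).measurable
  have hm4 : Measurable fun p : (E × E) × ℝ => G (p.1.2 + p.2 • (p.1.1 - p.1.2)) :=
    (hGc.comp (f := fun p : (E × E) × ℝ => p.1.2 + p.2 • (p.1.1 - p.1.2))
      (by fun_prop)).measurable
  have hm5 : Measurable fun p : E × E =>
      ∫⁻ t in Set.Ioc (0 : ℝ) 1, G (p.2 + t • (p.1 - p.2)) := hm4.lintegral_prod_right'
  have e1 : ∀ x, ∫⁻ y in S, c * (∫⁻ t in Set.Ioc (0 : ℝ) 1, G (y + t • (x - y))) ∂μ =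
      c * ∫⁻ t in Set.Ioc (0 : ℝ) 1, ∫⁻ y in S, G (y + t • (x - y)) ∂μ := by
    intro x
    have hm7 : Measurable fun y => ∫⁻ t in Set.Ioc (0 : ℝ) 1, G (y + t • (x - y)) :=
      hm5.comp measurable_prodMk_left
    rw [lintegral_const_mul _ hm7, lintegral_lintegral_swap]
    exact (hm4.comp ((measurable_const.prodMk measurable_fst).prodMk
      measurable_snd)).aemeasurable
  simp_rw [e1]
  have hm6 : Measurable fun p : E × ℝ => ∫⁻ y in S, G (y + p.2 • (p.1 - y)) ∂μ :=
    hm3.lintegral_prod_right'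
  rw [lintegral_const_mul _ hm6.lintegral_prod_right', lintegral_lintegral_swap]
  exact hm6.aemeasurable

/-- **Poincaré inequality** on a convex set, in double integral form. -/
lemma lintegral_enorm_sub_sq_le [CompleteSpace F] (μ : Measure E) [μ.IsAddHaarMeasure] {S : Set E}
    (hS : Convex ℝ S) (hSm : MeasurableSet S) {ℓ : ENNReal}
    (hdiam : ∀ x ∈ S, ∀ y ∈ S, ‖x - y‖ₑ ≤ ℓ) {f : E → F} (hf : ContDiff ℝ 1 f) :
    ∫⁻ x in S, ∫⁻ y in S, ‖f x - f y‖ₑ ^ 2 ∂μ ∂μ ≤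
      ℓ ^ 2 * (2 ^ Module.finrank ℝ E * μ S * ∫⁻ x in S, ‖fderiv ℝ f x‖ₑ ^ 2 ∂μ) := by
  set G : E → ENNReal := fun x => ‖fderiv ℝ f x‖ₑ ^ 2 with hGdef
  have hGc : Continuous G :=
    (ENNReal.continuous_pow 2).comp (hf.continuous_fderiv one_ne_zero).enorm
  have hG : Measurable G := hGc.measurable
  have hslice : ∀ t ∈ Set.Ioc (0 : ℝ) 1, ∫⁻ x in S, ∫⁻ y in S, G (y + t • (x - y)) ∂μ ∂μ ≤
      2 ^ Module.finrank ℝ E * μ S * ∫⁻ x in S, G x ∂μ := by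
    intro t ht
    have hconst : ∫⁻ _ in S, 2 ^ Module.finrank ℝ E * ∫⁻ x in S, G x ∂μ ∂μ
        = 2 ^ Module.finrank ℝ E * μ S * ∫⁻ x in S, G x ∂μ := by
      rw [setLIntegral_const]; ring
    rw [← hconst]
    rcases le_total (1 / 2) t with h | h
    · rw [lintegral_lintegral_swap]
      · exact setLIntegral_mono' hSm fun y hy => setLIntegral_homothety_le μ hS hSm hG hy h ht.2
      · refine Measurable.aemeasurable ?_
        exact (hGc.comp (f := fun p : E × E => p.2 + t • (p.1 - p.2)) (by fun_prop)).measurable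
    · refine setLIntegral_mono' hSm fun x hx => ?_
      have := setLIntegral_homothety_le μ hS hSm hG hx (t := 1 - t) (by linarith)
        (by linarith [ht.1])
      refine le_trans (le_of_eq (lintegral_congr fun y => congrArg G ?_)) this
      module
  calc ∫⁻ x in S, ∫⁻ y in S, ‖f x - f y‖ₑ ^ 2 ∂μ ∂μ
      ≤ ∫⁻ x in S, ∫⁻ y in S, ℓ ^ 2 *
          (∫⁻ t in Set.Ioc (0 : ℝ) 1, G (y + t • (x - y))) ∂μ ∂μ := by
        refine setLIntegral_mono' hSm fun x hx => setLIntegral_mono' hSm fun y hy => ?_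
        refine (enorm_sub_sq_le_lintegral_fderiv hf x y).trans ?_
        gcongr
        exact hdiam x hx y hy
    _ = ℓ ^ 2 * ∫⁻ t in Set.Ioc (0 : ℝ) 1, ∫⁻ x in S, ∫⁻ y in S, G (y + t • (x - y)) ∂μ ∂μ := by
        rw [lintegral_segment_swap μ S hGc]
    _ ≤ ℓ ^ 2 * ∫⁻ _ in Set.Ioc (0 : ℝ) 1,
          2 ^ Module.finrank ℝ E * μ S * ∫⁻ x in S, G x ∂μ := by
        gcongr ℓ ^ 2 * ?_
        exact setLIntegral_mono' measurableSet_Ioc hslice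
    _ = _ := by simp

end Poincare

/-- The cell with multi-index `k` of the partition of the unit cube into cubes of side `1 / n`. -/
def gridCell {ι : Type*} (n : ℕ) (k : ι → Fin n) : Set (ι → ℝ) :=
  Set.univ.pi fun i => Set.Ico ((k i : ℝ) / n) (((k i : ℝ) + 1) / n)

section Grid

variable {ι : Type*} {n : ℕ}

lemma eq_natFloor_of_mem_gridCell {k : ι → Fin n} {x : ι → ℝ} (hx : x ∈ gridCell n k) (i : ι) :
    (k i : ℕ) = ⌊n * x i⌋₊ := by
  have hn : (0 : ℝ) < n := by exact_mod_cast (k i).pos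
  obtain ⟨h1, h2⟩ := hx i (Set.mem_univ i)
  rw [div_le_iff₀ hn] at h1
  rw [lt_div_iff₀ hn] at h2
  symm
  rw [Nat.floor_eq_iff (by nlinarith [(k i : ℕ).cast_nonneg (α := ℝ)])]
  constructor <;> linarith

lemma pairwise_disjoint_gridCell :
    Pairwise (Function.onFun Disjoint (gridCell n : (ι → Fin n) → Set (ι → ℝ))) := by
  intro k l hkl
  rw [Function.onFun, Set.disjoint_left]
  intro x hk hl
  refine hkl (funext fun i => Fin.ext ?_)
  rw [eq_natFloor_of_mem_gridCell hk i, eq_natFloor_of_mem_gridCell hl i]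

lemma gridCell_subset_Icc (k : ι → Fin n) : gridCell n k ⊆ Set.Icc 0 1 := by
  intro x hx
  constructor <;> intro i <;> obtain ⟨h1, h2⟩ := hx i (Set.mem_univ i)
  · exact le_trans (by positivity) h1
  · refine h2.le.trans ?_
    have : ((k i : ℕ) : ℝ) + 1 ≤ n := by exact_mod_cast (k i).is_lt
    exact div_le_one_of_le₀ this (Nat.cast_nonneg n)

lemma pi_Ico_subset_iUnion_gridCell (hn : 0 < n) :
    (Set.univ.pi fun _ : ι => Set.Ico (0 : ℝ) 1) ⊆ ⋃ k, gridCell n k := by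
  intro x hx
  have hn' : (0 : ℝ) < n := by exact_mod_cast hn
  have hlt : ∀ i, ⌊n * x i⌋₊ < n := fun i => by
    obtain ⟨h1, h2⟩ := hx i (Set.mem_univ i)
    rw [Nat.floor_lt (by positivity)]
    nlinarith
  refine Set.mem_iUnion.2 ⟨fun i => ⟨⌊n * x i⌋₊, hlt i⟩, fun i _ => ?_⟩
  obtain ⟨h1, h2⟩ := hx i (Set.mem_univ i)
  simp only [Set.mem_Ico]
  rw [div_le_iff₀ hn', lt_div_iff₀ hn', mul_comm (x i)]
  exact ⟨Nat.floor_le (by positivity), Nat.lt_floor_add_one _⟩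

lemma convex_gridCell (k : ι → Fin n) : Convex ℝ (gridCell n k) :=
  convex_pi fun _ _ => convex_Ico _ _

variable [Fintype ι]

lemma measurableSet_gridCell (k : ι → Fin n) : MeasurableSet (gridCell n k) :=
  MeasurableSet.univ_pi fun _ => measurableSet_Ico

lemma volume_gridCell (hn : 0 < n) (k : ι → Fin n) :
    volume (gridCell n k) = ((n : ENNReal) ^ Fintype.card ι)⁻¹ := by
  have hn' : (0 : ℝ) < n := by exact_mod_cast hn
  rw [gridCell, Real.volume_pi_Ico]
  have : ∀ i, ENNReal.ofReal (((k i : ℝ) + 1) / n - (k i : ℝ) / n) = (n : ENNReal)⁻¹ := fun i => by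
    rw [← sub_div, add_sub_cancel_left, one_div, ENNReal.ofReal_inv_of_pos hn',
      ENNReal.ofReal_natCast]
  simp [this, ENNReal.inv_pow]

lemma enorm_sub_le_of_mem_gridCell (hn : 0 < n) {k : ι → Fin n} {x y : ι → ℝ}
    (hx : x ∈ gridCell n k) (hy : y ∈ gridCell n k) : ‖x - y‖ₑ ≤ (n : ENNReal)⁻¹ := by
  have hn' : (0 : ℝ) < n := by exact_mod_cast hn
  rw [← ENNReal.ofReal_natCast, ← ENNReal.ofReal_inv_of_pos hn', ← ofReal_norm]
  refine ENNReal.ofReal_le_ofReal ((pi_norm_le_iff_of_nonneg (by positivity)).2 fun i => ?_)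
  obtain ⟨h1, h2⟩ := hx i (Set.mem_univ i)
  obtain ⟨h3, h4⟩ := hy i (Set.mem_univ i)
  rw [add_div, one_div] at h2 h4
  rw [Pi.sub_apply, Real.norm_eq_abs, abs_le]
  constructor <;> linarith

/-- If `f` has small `L²` mass on the scale `1 / n`, then the set where `f` attains the value `s`
is controlled by the Dirichlet energy with a gain of `n²`. -/
lemma volume_level_le_lintegral_fderiv (hn : 0 < n) {f : (ι → ℝ) → ℝ} (hf : ContDiff ℝ 1 f)
    {s : ℝ}
    (hsmall : (n : ENNReal) ^ Fintype.card ι * ∫⁻ x in Set.Icc 0 1, ‖f x‖ₑ ^ 2 ≤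
      ENNReal.ofReal (s ^ 2 / 4)) :
    (n : ENNReal) ^ 2 * ENNReal.ofReal (s ^ 2 / 4) * volume ({x | f x = s} ∩ Set.Icc 0 1) ≤
      2 ^ Fintype.card ι * ∫⁻ x in Set.Icc 0 1, ‖fderiv ℝ f x‖ₑ ^ 2 := by
  classical
  set K := ENNReal.ofReal (s ^ 2 / 4) with hK
  have hKtop : K ≠ ⊤ := ENNReal.ofReal_ne_top
  set A : Set (ι → ℝ) := {x | f x = s} with hA
  have hAm : MeasurableSet A := (isClosed_eq hf.continuous continuous_const).measurableSet
  have hn0 : (n : ENNReal) ≠ 0 := by exact_mod_cast hn.ne'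
  have hntop : (n : ENNReal) ≠ ⊤ := ENNReal.natCast_ne_top n
  set v := ((n : ENNReal) ^ Fintype.card ι)⁻¹ with hv
  have hv0 : v ≠ 0 := ENNReal.inv_ne_zero.2 (ENNReal.pow_ne_top hntop)
  have hvtop : v ≠ ⊤ := ENNReal.inv_ne_top.2 (pow_ne_zero _ hn0)
  have hpt : ∀ x ∈ A, ∀ y, K + K ≤ ‖f x - f y‖ₑ ^ 2 + ‖f y‖ₑ ^ 2 := by
    intro x hx y
    rw [hA, Set.mem_ofPred_eq] at hx
    rw [hx, hK, ← ofReal_norm, ← ofReal_norm, ← ENNReal.ofReal_pow (norm_nonneg _),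
      ← ENNReal.ofReal_pow (norm_nonneg _), ← ENNReal.ofReal_add (by positivity) (by positivity),
      ← ENNReal.ofReal_add (by positivity) (by positivity), Real.norm_eq_abs, Real.norm_eq_abs,
      sq_abs, sq_abs]
    refine ENNReal.ofReal_le_ofReal ?_
    nlinarith [sq_nonneg (s - 2 * f y)]
  have hfm : Measurable fun y => ‖f y‖ₑ ^ 2 := hf.continuous.enorm.measurable.pow_const 2
  have hcell : ∀ k : ι → Fin n, (n : ENNReal) ^ 2 * K * volume (A ∩ gridCell n k) ≤
      2 ^ Fintype.card ι * ∫⁻ x in gridCell n k, ‖fderiv ℝ f x‖ₑ ^ 2 := by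
    intro k
    have hQm := measurableSet_gridCell k
    have hQv : volume (gridCell n k) = v := volume_gridCell hn k
    have hmass : ∫⁻ y in gridCell n k, ‖f y‖ₑ ^ 2 ≤ K * v := by
      rw [hv, ← div_eq_mul_inv, ENNReal.le_div_iff_mul_le (Or.inl (pow_ne_zero _ hn0))
        (Or.inl (ENNReal.pow_ne_top hntop)), mul_comm]
      refine le_trans ?_ hsmall
      gcongr
      exact gridCell_subset_Icc k
    have hinner : ∀ x ∈ A ∩ gridCell n k,
        K * v ≤ ∫⁻ y in gridCell n k, ‖f x - f y‖ₑ ^ 2 := by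
      intro x hx
      have h1 : (K + K) * v ≤ (∫⁻ y in gridCell n k, ‖f x - f y‖ₑ ^ 2) + K * v := by
        calc (K + K) * v = ∫⁻ _ in gridCell n k, (K + K) := by rw [setLIntegral_const, hQv]
          _ ≤ ∫⁻ y in gridCell n k, (‖f x - f y‖ₑ ^ 2 + ‖f y‖ₑ ^ 2) :=
              lintegral_mono fun y => hpt x hx.1 y
          _ = (∫⁻ y in gridCell n k, ‖f x - f y‖ₑ ^ 2) + ∫⁻ y in gridCell n k, ‖f y‖ₑ ^ 2 :=
              lintegral_add_right _ hfm
          _ ≤ _ := by gcongr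
      rw [add_mul] at h1
      exact (ENNReal.add_le_add_iff_right (ENNReal.mul_ne_top hKtop hvtop)).1 h1
    have hP := lintegral_enorm_sub_sq_le volume (convex_gridCell k) hQm
      (fun x hx y hy => enorm_sub_le_of_mem_gridCell hn hx hy) hf
    rw [hQv, Module.finrank_fintype_fun_eq_card] at hP
    have h2 : K * v * volume (A ∩ gridCell n k) ≤
        ((n : ENNReal)⁻¹) ^ 2 * (2 ^ Fintype.card ι * v *
          ∫⁻ x in gridCell n k, ‖fderiv ℝ f x‖ₑ ^ 2) := by
      refine le_trans ?_ hP
      rw [← setLIntegral_const]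
      refine (setLIntegral_mono' (hAm.inter hQm) hinner).trans ?_
      exact lintegral_mono_set Set.inter_subset_right
    have h3 : v * ((n : ENNReal) ^ 2 * K * volume (A ∩ gridCell n k)) ≤
        v * (2 ^ Fintype.card ι * ∫⁻ x in gridCell n k, ‖fderiv ℝ f x‖ₑ ^ 2) := by
      calc v * ((n : ENNReal) ^ 2 * K * volume (A ∩ gridCell n k))
          = (n : ENNReal) ^ 2 * (K * v * volume (A ∩ gridCell n k)) := by ring
        _ ≤ (n : ENNReal) ^ 2 * (((n : ENNReal)⁻¹) ^ 2 * (2 ^ Fintype.card ι * v *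
          ∫⁻ x in gridCell n k, ‖fderiv ℝ f x‖ₑ ^ 2)) := by gcongr
        _ = ((n : ENNReal) * (n : ENNReal)⁻¹) ^ 2 * (v * (2 ^ Fintype.card ι *
          ∫⁻ x in gridCell n k, ‖fderiv ℝ f x‖ₑ ^ 2)) := by ring
        _ = _ := by rw [ENNReal.mul_inv_cancel hn0 hntop]; simp
    exact (ENNReal.mul_le_mul_iff_right hv0 hvtop).1 h3
  have hae : (Set.univ.pi fun _ : ι => Set.Ico (0 : ℝ) 1) =ᵐ[volume] (Set.Icc 0 1 : Set (ι → ℝ)) :=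
    Measure.univ_pi_Ico_ae_eq_Icc
  calc (n : ENNReal) ^ 2 * K * volume (A ∩ Set.Icc 0 1)
      = (n : ENNReal) ^ 2 * K * volume (A ∩ Set.univ.pi fun _ : ι => Set.Ico (0 : ℝ) 1) := by
        rw [measure_congr ((ae_eq_refl A).inter hae)]
    _ ≤ (n : ENNReal) ^ 2 * K * ∑ k : ι → Fin n, volume (A ∩ gridCell n k) := by
        gcongr
        refine (measure_mono (Set.inter_subset_inter_right A
          (pi_Ico_subset_iUnion_gridCell hn))).trans ?_
        rw [Set.inter_iUnion]
        exact measure_iUnion_fintype_le _ _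
    _ ≤ ∑ k : ι → Fin n, 2 ^ Fintype.card ι * ∫⁻ x in gridCell n k, ‖fderiv ℝ f x‖ₑ ^ 2 := by
        rw [Finset.mul_sum]
        exact Finset.sum_le_sum fun k _ => hcell k
    _ = 2 ^ Fintype.card ι * ∫⁻ x in ⋃ k : ι → Fin n, gridCell n k, ‖fderiv ℝ f x‖ₑ ^ 2 := by
        rw [← Finset.mul_sum, lintegral_iUnion measurableSet_gridCell pairwise_disjoint_gridCell,
          tsum_fintype]
    _ ≤ _ := by
        gcongr
        exact Set.iUnion_subset gridCell_subset_Icc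

end Grid

lemma deriv_smoothTransition_eq_zero {s : ℝ} (hs : s ≤ 0 ∨ 1 ≤ s) :
    deriv Real.smoothTransition s = 0 := by
  rcases hs with hs | hs
  · refine IsLocalMin.deriv_eq_zero (Filter.Eventually.of_forall fun t => ?_)
    rw [Real.smoothTransition.zero_of_nonpos hs]
    exact Real.smoothTransition.nonneg t
  · refine IsLocalMax.deriv_eq_zero (Filter.Eventually.of_forall fun t => ?_)
    rw [Real.smoothTransition.one_of_one_le hs]
    exact Real.smoothTransition.le_one t

lemma exists_abs_deriv_smoothTransition_le : ∃ B : ℝ, ∀ s, |deriv Real.smoothTransition s| ≤ B := by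
  have hc : Continuous (deriv Real.smoothTransition) :=
    (Real.smoothTransition.contDiff (n := 1)).continuous_deriv le_rfl
  obtain ⟨B, hB⟩ := (isCompact_Icc (a := (0 : ℝ)) (b := 1)).exists_bound_of_continuousOn
    hc.continuousOn
  refine ⟨B, fun s => ?_⟩
  by_cases hs : s ∈ Set.Icc (0 : ℝ) 1
  · exact hB s hs
  · rw [deriv_smoothTransition_eq_zero, abs_zero]
    · exact (norm_nonneg _).trans (hB 0 ⟨le_rfl, zero_le_one⟩)
    · by_contra! h
      exact hs ⟨h.1.le, h.2.le⟩

/-- The density `∑ⱼ |ψⱼ|²` of a finite family of functions. -/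
def familyDensity {X κ : Type*} [Fintype κ] (ψ : κ → X → ℂ) (x : X) : ℝ := ∑ j, ‖ψ j x‖ ^ 2

lemma familyDensity_nonneg {X κ : Type*} [Fintype κ] (ψ : κ → X → ℂ) (x : X) :
    0 ≤ familyDensity ψ x :=
  Finset.sum_nonneg fun _ _ => by positivity

section Density

variable {E : Type*} [NormedAddCommGroup E] [NormedSpace ℝ E] {κ : Type*} [Fintype κ]

/-- The sum of the squared norms of the derivatives of a finite family of functions. -/
def energyDensity (ψ : κ → E → ℂ) (x : E) : ℝ := ∑ j, ‖fderiv ℝ (ψ j) x‖ ^ 2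

lemma energyDensity_nonneg (ψ : κ → E → ℂ) (x : E) : 0 ≤ energyDensity ψ x :=
  Finset.sum_nonneg fun _ _ => by positivity

variable {ψ : κ → E → ℂ}

lemma contDiff_familyDensity (hψ : ∀ j, ContDiff ℝ 1 (ψ j)) : ContDiff ℝ 1 (familyDensity ψ) :=
  ContDiff.sum fun j _ => (hψ j).norm_sq ℝ

lemma norm_fderiv_familyDensity_sq_le (hψ : ∀ j, ContDiff ℝ 1 (ψ j)) (x : E) :
    ‖fderiv ℝ (familyDensity ψ) x‖ ^ 2 ≤ 4 * familyDensity ψ x * energyDensity ψ x := by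
  have hd : HasFDerivAt (familyDensity ψ)
      (∑ j, 2 • (innerSL ℝ (ψ j x)).comp (fderiv ℝ (ψ j) x)) x := by
    refine HasFDerivAt.fun_sum fun j _ => ?_
    exact ((hψ j).differentiable one_ne_zero x).hasFDerivAt.norm_sq
  have h1 : ‖fderiv ℝ (familyDensity ψ) x‖ ≤ 2 * ∑ j, ‖ψ j x‖ * ‖fderiv ℝ (ψ j) x‖ := by
    rw [hd.fderiv, Finset.mul_sum]
    refine (norm_sum_le _ _).trans (Finset.sum_le_sum fun j _ => ?_)
    refine (norm_nsmul_le).trans ?_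
    rw [Nat.cast_ofNat]
    gcongr
    refine (ContinuousLinearMap.opNorm_comp_le _ _).trans ?_
    rw [innerSL_apply_norm]
  calc ‖fderiv ℝ (familyDensity ψ) x‖ ^ 2 ≤ (2 * ∑ j, ‖ψ j x‖ * ‖fderiv ℝ (ψ j) x‖) ^ 2 := by
        gcongr
    _ = 4 * (∑ j, ‖ψ j x‖ * ‖fderiv ℝ (ψ j) x‖) ^ 2 := by ring
    _ ≤ 4 * (familyDensity ψ x * energyDensity ψ x) := by
        gcongr
        exact Finset.sum_mul_sq_le_sq_mul_sq _ _ _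
    _ = _ := by ring

/-- A smooth truncation of the square root of the density between the levels `s` and `2 * s`,
whose derivative is controlled by the energy density. -/
lemma exists_truncation : ∃ B : ℝ, 0 < B ∧ ∀ {E : Type*} [NormedAddCommGroup E] [NormedSpace ℝ E]
    {κ : Type*} [Fintype κ] {ψ : κ → E → ℂ}, (∀ j, ContDiff ℝ 1 (ψ j)) → ∀ {s : ℝ}, 0 < s →
    ∃ f : E → ℝ, ContDiff ℝ 1 f ∧ (∀ x, f x ^ 2 ≤ familyDensity ψ x) ∧
      (∀ x, 4 * s ^ 2 ≤ familyDensity ψ x → f x = s) ∧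
      (∀ x, ‖fderiv ℝ f x‖ ^ 2 ≤ B * energyDensity ψ x) ∧
      ∀ x, ¬ (s ^ 2 ≤ familyDensity ψ x ∧ familyDensity ψ x < 4 * s ^ 2) → fderiv ℝ f x = 0 := by
  obtain ⟨B, hB⟩ := exists_abs_deriv_smoothTransition_le
  refine ⟨2 * B ^ 2 + 1, by positivity, ?_⟩
  intro E _ _ κ _ ψ hψ s hs
  set ρ := familyDensity ψ with hρ
  have hρc := contDiff_familyDensity hψ
  set w : E → ℝ := fun x => (ρ x - s ^ 2) / (3 * s ^ 2) with hw
  have hwd : ∀ x, HasFDerivAt w ((3 * s ^ 2)⁻¹ • fderiv ℝ ρ x) x := by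
    intro x
    simp only [hw, div_eq_inv_mul]
    exact (((hρc.differentiable one_ne_zero x).hasFDerivAt).sub_const _).const_mul _
  have hfd : ∀ x, HasFDerivAt (fun x => s * Real.smoothTransition (w x))
      (s • (deriv Real.smoothTransition (w x) • ((3 * s ^ 2)⁻¹ • fderiv ℝ ρ x))) x := by
    intro x
    have h := ((Real.smoothTransition.contDiff (n := 1)).differentiable one_ne_zero
      (w x)).hasDerivAt
    exact (h.comp_hasFDerivAt x (hwd x)).const_mul s
  have hzero : ∀ x, ¬ (s ^ 2 ≤ ρ x ∧ ρ x < 4 * s ^ 2) →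
      fderiv ℝ (fun x => s * Real.smoothTransition (w x)) x = 0 := by
    intro x hx
    rw [(hfd x).fderiv, deriv_smoothTransition_eq_zero, zero_smul, smul_zero]
    rcases lt_or_ge (ρ x) (s ^ 2) with h | h
    · exact Or.inl (div_nonpos_of_nonpos_of_nonneg (by linarith) (by positivity))
    · have h' : 4 * s ^ 2 ≤ ρ x := by by_contra! h'; exact hx ⟨h, h'⟩
      refine Or.inr ?_
      rw [hw, one_le_div (by positivity)]
      linarith
  refine ⟨fun x => s * Real.smoothTransition (w x), ?_, ?_, ?_, ?_, hzero⟩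
  · exact contDiff_const.mul ((Real.smoothTransition.contDiff (n := 1)).comp
      ((hρc.sub contDiff_const).div_const _))
  · intro x
    rcases le_total (ρ x) (s ^ 2) with h | h
    · have h0 : w x ≤ 0 := div_nonpos_of_nonpos_of_nonneg (by linarith) (by positivity)
      simp only [Real.smoothTransition.zero_of_nonpos h0]
      simpa using familyDensity_nonneg ψ x
    · refine le_trans ?_ h
      have h0 := Real.smoothTransition.nonneg (w x)
      have h1 := Real.smoothTransition.le_one (w x)
      have h2 : s * Real.smoothTransition (w x) ≤ s := by nlinarith
      gcongr
  · intro x hx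
    have h1 : 1 ≤ w x := by
      rw [hw, one_le_div (by positivity)]
      linarith
    simp only [Real.smoothTransition.one_of_one_le h1, mul_one]
  · intro x
    have he := energyDensity_nonneg ψ x
    by_cases hx : s ^ 2 ≤ ρ x ∧ ρ x < 4 * s ^ 2
    · rw [(hfd x).fderiv, norm_smul, norm_smul, norm_smul, Real.norm_eq_abs, Real.norm_eq_abs,
        Real.norm_eq_abs, abs_of_pos hs, abs_of_pos (by positivity : 0 < (3 * s ^ 2)⁻¹)]
      have h1 : |deriv Real.smoothTransition (w x)| ^ 2 ≤ B ^ 2 := by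
        have := hB (w x)
        gcongr
      have h2 : ‖fderiv ℝ ρ x‖ ^ 2 ≤ 16 * s ^ 2 * energyDensity ψ x := by
        refine (norm_fderiv_familyDensity_sq_le hψ x).trans ?_
        have h3 : 4 * ρ x ≤ 16 * s ^ 2 := by linarith [hx.2]
        gcongr
      calc (s * (|deriv Real.smoothTransition (w x)| * ((3 * s ^ 2)⁻¹ * ‖fderiv ℝ ρ x‖))) ^ 2
          = s ^ 2 * ((3 * s ^ 2)⁻¹) ^ 2 *
            (|deriv Real.smoothTransition (w x)| ^ 2 * ‖fderiv ℝ ρ x‖ ^ 2) := by ring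
        _ ≤ s ^ 2 * ((3 * s ^ 2)⁻¹) ^ 2 * (B ^ 2 * (16 * s ^ 2 * energyDensity ψ x)) := by gcongr
        _ = 16 / 9 * B ^ 2 * energyDensity ψ x := by field_simp; ring
        _ ≤ (2 * B ^ 2 + 1) * energyDensity ψ x := by
            gcongr
            nlinarith [sq_nonneg B]
    · rw [hzero x hx, norm_zero, zero_pow two_ne_zero]
      exact mul_nonneg (by positivity) he

end Density

lemma enorm_sq_eq_ofReal {F : Type*} [SeminormedAddCommGroup F] (x : F) :
    ‖x‖ₑ ^ 2 = ENNReal.ofReal (‖x‖ ^ 2) := by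
  rw [← ofReal_norm, ENNReal.ofReal_pow (norm_nonneg _)]

section Shell

variable {X κ : Type*} [Fintype κ]

/-- The set where the square root of the density is between `2 ^ (j + 1) * a` and
`2 ^ (j + 2) * a`. -/
def densityShell (ψ : κ → X → ℂ) (a : ℝ) (j : ℕ) : Set X :=
  {x | 4 ^ (j + 1) * a ^ 2 ≤ familyDensity ψ x ∧ familyDensity ψ x < 4 ^ (j + 2) * a ^ 2}

lemma pairwise_disjoint_densityShell (ψ : κ → X → ℂ) (a : ℝ) :
    Pairwise (Function.onFun Disjoint (densityShell ψ a)) := by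
  have hlt : ∀ {i j x}, i < j → x ∈ densityShell ψ a i → x ∉ densityShell ψ a j := by
    intro i j x hij hi hj
    have h1 : (4 : ℝ) ^ (i + 2) * a ^ 2 ≤ 4 ^ (j + 1) * a ^ 2 := by
      gcongr ?_ * _
      exact pow_le_pow_right₀ (by norm_num) (by omega)
    linarith [hi.2, hj.1]
  intro i j hij
  rw [Function.onFun, Set.disjoint_left]
  intro x hi hj
  rcases lt_or_gt_of_ne hij with h | h
  · exact hlt h hi hj
  · exact hlt h hj hi

lemma setOf_le_familyDensity_subset_iUnion (ψ : κ → X → ℂ) {a : ℝ} (ha : 0 < a) :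
    {x | 16 * a ^ 2 ≤ familyDensity ψ x} ⊆ ⋃ j, densityShell ψ a (j + 1) := by
  intro x hx
  have hx : 16 * a ^ 2 ≤ familyDensity ψ x := hx
  have h1 : 1 ≤ familyDensity ψ x / (16 * a ^ 2) := by rwa [one_le_div (by positivity)]
  obtain ⟨j, hj1, hj2⟩ := exists_nat_pow_near h1 (by norm_num : (1 : ℝ) < 4)
  rw [le_div_iff₀ (by positivity)] at hj1
  rw [div_lt_iff₀ (by positivity)] at hj2
  refine Set.mem_iUnion.2 ⟨j, ?_, ?_⟩
  · calc (4 : ℝ) ^ (j + 1 + 1) * a ^ 2 = 4 ^ j * (16 * a ^ 2) := by ring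
      _ ≤ _ := hj1
  · calc familyDensity ψ x < _ := hj2
      _ = (4 : ℝ) ^ (j + 1 + 2) * a ^ 2 := by ring

lemma measurableSet_densityShell {E : Type*} [NormedAddCommGroup E] [NormedSpace ℝ E]
    [MeasurableSpace E] [BorelSpace E] {ψ : κ → E → ℂ}
    (hψ : ∀ j, ContDiff ℝ 1 (ψ j)) (a : ℝ) (j : ℕ) :
    MeasurableSet (densityShell ψ a j) :=
  (contDiff_familyDensity hψ).continuous.measurable measurableSet_Ico

end Shell

/-- Weak-type estimate for the density at a fixed level. -/
lemma exists_volume_familyDensity_le : ∃ B : ℝ, 0 < B ∧ ∀ {ι κ : Type*} [Fintype ι] [Fintype κ]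
    {ψ : κ → (ι → ℝ) → ℂ}, (∀ j, ContDiff ℝ 1 (ψ j)) → ∀ {s : ℝ}, 0 < s → ∀ {n : ℕ}, 0 < n →
    (n : ENNReal) ^ Fintype.card ι * ∫⁻ x in Set.Icc 0 1, ENNReal.ofReal (familyDensity ψ x) ≤
      ENNReal.ofReal (s ^ 2 / 4) →
    (n : ENNReal) ^ 2 * ENNReal.ofReal (s ^ 2 / 4) *
        volume ({x | 4 * s ^ 2 ≤ familyDensity ψ x} ∩ Set.Icc 0 1) ≤
      2 ^ Fintype.card ι * (ENNReal.ofReal B *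
        ∫⁻ x in {x | s ^ 2 ≤ familyDensity ψ x ∧ familyDensity ψ x < 4 * s ^ 2} ∩ Set.Icc 0 1,
          ENNReal.ofReal (energyDensity ψ x)) := by
  obtain ⟨B, hB, htr⟩ := exists_truncation
  refine ⟨B, hB, ?_⟩
  intro ι κ _ _ ψ hψ s hs n hn hsmall
  obtain ⟨f, hf, hfρ, hfs, hfd, hf0⟩ := htr hψ hs
  have hρm := (contDiff_familyDensity hψ).continuous.measurable
  have hmeas : MeasurableSet
      {x | s ^ 2 ≤ familyDensity ψ x ∧ familyDensity ψ x < 4 * s ^ 2} := hρm measurableSet_Ico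
  have h := volume_level_le_lintegral_fderiv hn hf (s := s) (by
    refine le_trans ?_ hsmall
    gcongr with x
    rw [enorm_sq_eq_ofReal, Real.norm_eq_abs, sq_abs]
    exact ENNReal.ofReal_le_ofReal (hfρ x))
  calc _ ≤ (n : ENNReal) ^ 2 * ENNReal.ofReal (s ^ 2 / 4) *
        volume ({x | f x = s} ∩ Set.Icc 0 1) := by
        gcongr
        exact hfs _
    _ ≤ _ := h
    _ ≤ _ := by
        gcongr
        rw [← lintegral_const_mul' _ _ ENNReal.ofReal_ne_top,
          ← setLIntegral_indicator hmeas]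
        gcongr with x
        rw [enorm_sq_eq_ofReal]
        by_cases hx : x ∈ {x | s ^ 2 ≤ familyDensity ψ x ∧ familyDensity ψ x < 4 * s ^ 2}
        · rw [Set.indicator_of_mem hx, ← ENNReal.ofReal_mul hB.le]
          exact ENNReal.ofReal_le_ofReal (hfd x)
        · rw [hf0 x hx]
          simp

/-- A natural number comparable from below to `4 ^ (j / D)`. -/
lemma exists_nat_pow_le_four_pow {D : ℕ} (hD : 0 < D) (j : ℕ) :
    ∃ n : ℕ, 0 < n ∧ n ^ D ≤ 4 ^ j ∧ ((2 : ℝ) ^ j) ^ (4 / (D : ℝ)) ≤ 4 * (n : ℝ) ^ 2 := by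
  have hD' : (0 : ℝ) < D := by exact_mod_cast hD
  set r : ℝ := ((4 : ℝ) ^ j) ^ (1 / (D : ℝ)) with hr
  have hr1 : 1 ≤ r := Real.one_le_rpow (one_le_pow₀ (by norm_num)) (by positivity)
  have hrD : r ^ D = 4 ^ j := by
    rw [hr, ← Real.rpow_natCast, ← Real.rpow_mul (by positivity), one_div_mul_cancel hD'.ne',
      Real.rpow_one]
  have hfl : 1 ≤ ⌊r⌋₊ := (Nat.one_le_floor_iff r).2 hr1
  have hfl' : (1 : ℝ) ≤ ⌊r⌋₊ := by exact_mod_cast hfl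
  refine ⟨⌊r⌋₊, hfl, ?_, ?_⟩
  · have : ((⌊r⌋₊ : ℝ)) ^ D ≤ 4 ^ j := by
      rw [← hrD]
      gcongr
      exact Nat.floor_le (by positivity)
    exact_mod_cast this
  · have h2 : ((2 : ℝ) ^ j) ^ (4 / (D : ℝ)) = r ^ 2 := by
      rw [hr, show (4 : ℝ) ^ j = ((2 : ℝ) ^ j) ^ (2 : ℝ) by
          rw [Real.rpow_two, ← pow_mul, mul_comm, pow_mul]; norm_num,
        ← Real.rpow_mul (by positivity), ← Real.rpow_two, ← Real.rpow_mul (by positivity)]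
      congr 1
      ring
    have h3 : r ≤ 2 * ⌊r⌋₊ := by linarith [Nat.lt_floor_add_one r]
    rw [h2]
    calc r ^ 2 ≤ (2 * (⌊r⌋₊ : ℝ)) ^ 2 := by gcongr
      _ = _ := by ring

/-- Integral of a power of the square root of the density over the region of high density. -/
lemma exists_setLIntegral_high_density_le {D : ℕ} (hD : 0 < D) : ∃ C : ℝ, 0 < C ∧
    ∀ {ι κ : Type*} [Fintype ι] [Fintype κ], Fintype.card ι = D →
    ∀ {ψ : κ → (ι → ℝ) → ℂ}, (∀ j, ContDiff ℝ 1 (ψ j)) → ∀ {a : ℝ}, 0 < a →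
    ∫⁻ x in Set.Icc 0 1, ENNReal.ofReal (familyDensity ψ x) = ENNReal.ofReal (a ^ 2) →
    ∫⁻ x in {x | 16 * a ^ 2 ≤ familyDensity ψ x} ∩ Set.Icc 0 1,
        ENNReal.ofReal (√(familyDensity ψ x) ^ (2 + 4 / (D : ℝ))) ≤
      ENNReal.ofReal (C * a ^ (4 / (D : ℝ))) *
        ∫⁻ x in Set.Icc 0 1, ENNReal.ofReal (energyDensity ψ x) := by
  obtain ⟨B, hB, hweak⟩ := exists_volume_familyDensity_le
  have hD' : (0 : ℝ) < D := by exact_mod_cast hD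
  set q : ℝ := 4 / (D : ℝ) with hq
  have hq0 : 0 < q := by positivity
  set p : ℝ := 2 + q with hp
  refine ⟨4 ^ p * 16 * 2 ^ q * 2 ^ D * B, by positivity, ?_⟩
  intro ι κ _ _ hcard ψ hψ a ha hmass
  have hρm := (contDiff_familyDensity hψ).continuous.measurable
  set I : Set (ι → ℝ) := Set.Icc 0 1 with hI
  have hIm : MeasurableSet I := measurableSet_Icc
  set g : (ι → ℝ) → ENNReal := fun x => ENNReal.ofReal (energyDensity ψ x) with hg
  have hshell : ∀ j, ∫⁻ x in densityShell ψ a (j + 1) ∩ I,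
      ENNReal.ofReal (√(familyDensity ψ x) ^ p) ≤
      ENNReal.ofReal (4 ^ p * 16 * 2 ^ q * 2 ^ D * B * a ^ q) *
        ∫⁻ x in densityShell ψ a j ∩ I, g x := by
    intro j
    obtain ⟨n, hn, hn1, hn2⟩ := exists_nat_pow_le_four_pow hD j
    set s : ℝ := 2 ^ j * (2 * a) with hs
    have hs0 : 0 < s := by positivity
    have hs2 : s ^ 2 = 4 ^ (j + 1) * a ^ 2 := by
      rw [hs, mul_pow, ← pow_mul, mul_comm j 2, pow_mul]
      norm_num
      ring
    have hset : {x | s ^ 2 ≤ familyDensity ψ x ∧ familyDensity ψ x < 4 * s ^ 2} =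
        densityShell ψ a j := by
      rw [hs2, densityShell, show (4 : ℝ) ^ (j + 2) * a ^ 2 = 4 * (4 ^ (j + 1) * a ^ 2) by ring]
    have hw := hweak hψ hs0 hn (by
      rw [hmass, hcard, hs2, ← Nat.cast_pow, ← ENNReal.ofReal_natCast,
        ← ENNReal.ofReal_mul (by positivity)]
      refine ENNReal.ofReal_le_ofReal ?_
      have : ((n ^ D : ℕ) : ℝ) ≤ 4 ^ j := by exact_mod_cast hn1
      calc ((n ^ D : ℕ) : ℝ) * a ^ 2 ≤ 4 ^ j * a ^ 2 := by gcongr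
        _ = _ := by ring)
    rw [hset, hcard] at hw
    have hpow : (4 * s) ^ p ≤ 4 ^ p * 16 * (2 ^ q * a ^ q) * ((n : ℝ) ^ 2 * (s ^ 2 / 4)) := by
      have e1 : s ^ q = ((2 : ℝ) ^ j) ^ q * (2 ^ q * a ^ q) := by
        rw [hs, Real.mul_rpow (by positivity) (by positivity), Real.mul_rpow (by positivity) ha.le]
      rw [Real.mul_rpow (by positivity) hs0.le, hp, Real.rpow_add hs0, Real.rpow_two, e1, ← hp]
      calc (4 : ℝ) ^ p * (s ^ 2 * (((2 : ℝ) ^ j) ^ q * (2 ^ q * a ^ q)))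
          ≤ (4 : ℝ) ^ p * (s ^ 2 * ((4 * (n : ℝ) ^ 2) * (2 ^ q * a ^ q))) := by gcongr
        _ = _ := by ring
    calc ∫⁻ x in densityShell ψ a (j + 1) ∩ I, ENNReal.ofReal (√(familyDensity ψ x) ^ p)
        ≤ ∫⁻ _ in densityShell ψ a (j + 1) ∩ I, ENNReal.ofReal ((4 * s) ^ p) := by
          refine setLIntegral_mono' ((measurableSet_densityShell hψ a _).inter hIm) fun x hx => ?_
          refine ENNReal.ofReal_le_ofReal ?_
          gcongr
          rw [Real.sqrt_le_left (by positivity)]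
          refine hx.1.2.le.trans (le_of_eq ?_)
          rw [mul_pow, hs2]
          ring
      _ = ENNReal.ofReal ((4 * s) ^ p) * volume (densityShell ψ a (j + 1) ∩ I) :=
          setLIntegral_const _ _
      _ ≤ ENNReal.ofReal (4 ^ p * 16 * (2 ^ q * a ^ q) * ((n : ℝ) ^ 2 * (s ^ 2 / 4))) *
            volume ({x | 4 * s ^ 2 ≤ familyDensity ψ x} ∩ I) := by
          gcongr
          intro x hx
          refine le_trans (le_of_eq ?_) hx.1
          rw [hs2]
          ring
      _ = ENNReal.ofReal (4 ^ p * 16 * (2 ^ q * a ^ q)) * ((n : ENNReal) ^ 2 *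
            ENNReal.ofReal (s ^ 2 / 4) * volume ({x | 4 * s ^ 2 ≤ familyDensity ψ x} ∩ I)) := by
          rw [ENNReal.ofReal_mul (by positivity), ENNReal.ofReal_mul (p := (n : ℝ) ^ 2)
            (by positivity), ENNReal.ofReal_pow (by positivity), ENNReal.ofReal_natCast]
          ring
      _ ≤ ENNReal.ofReal (4 ^ p * 16 * (2 ^ q * a ^ q)) *
            (2 ^ D * (ENNReal.ofReal B * ∫⁻ x in densityShell ψ a j ∩ I, g x)) := by gcongr
      _ = _ := by
          rw [show (2 : ENNReal) ^ D = ENNReal.ofReal (2 ^ D) by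
            rw [ENNReal.ofReal_pow zero_le_two, ENNReal.ofReal_ofNat]]
          rw [← mul_assoc, ← mul_assoc, ← ENNReal.ofReal_mul (by positivity),
            ← ENNReal.ofReal_mul (by positivity)]
          congr 2
          ring
  have hdisj : Pairwise (Function.onFun Disjoint fun j => densityShell ψ a j ∩ I) :=
    fun i j hij => (pairwise_disjoint_densityShell ψ a hij).mono
      Set.inter_subset_left Set.inter_subset_left
  calc ∫⁻ x in {x | 16 * a ^ 2 ≤ familyDensity ψ x} ∩ I,
        ENNReal.ofReal (√(familyDensity ψ x) ^ p)
      ≤ ∫⁻ x in ⋃ j, densityShell ψ a (j + 1) ∩ I, ENNReal.ofReal (√(familyDensity ψ x) ^ p) := by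
        refine lintegral_mono_set ?_
        rw [← Set.iUnion_inter]
        exact Set.inter_subset_inter_left _ (setOf_le_familyDensity_subset_iUnion ψ ha)
    _ ≤ ∑' j, ∫⁻ x in densityShell ψ a (j + 1) ∩ I, ENNReal.ofReal (√(familyDensity ψ x) ^ p) :=
        lintegral_iUnion_le _ _
    _ ≤ ∑' j, ENNReal.ofReal (4 ^ p * 16 * 2 ^ q * 2 ^ D * B * a ^ q) *
        ∫⁻ x in densityShell ψ a j ∩ I, g x := ENNReal.tsum_le_tsum hshell
    _ = ENNReal.ofReal (4 ^ p * 16 * 2 ^ q * 2 ^ D * B * a ^ q) *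
        ∫⁻ x in ⋃ j, densityShell ψ a j ∩ I, g x := by
        rw [ENNReal.tsum_mul_left, lintegral_iUnion
          (fun j => (measurableSet_densityShell hψ a j).inter hIm) hdisj]
    _ ≤ _ := by
        gcongr
        exact Set.iUnion_subset fun j => Set.inter_subset_right

lemma sqrt_familyDensity_sub_sq_le {X κ : Type*} [Fintype κ] (ψ : κ → X → ℂ) (x y : X) :
    (√(familyDensity ψ x) - √(familyDensity ψ y)) ^ 2 ≤ ∑ j, ‖ψ j x - ψ j y‖ ^ 2 := by
  have hn : ∀ x, √(familyDensity ψ x) = ‖WithLp.toLp 2 fun j => ψ j x‖ := fun x => by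
    rw [EuclideanSpace.norm_eq]
    rfl
  have h := abs_norm_sub_norm_le (WithLp.toLp 2 fun j => ψ j x) (WithLp.toLp 2 fun j => ψ j y)
  rw [hn, hn, ← sq_abs]
  calc _ ≤ ‖(WithLp.toLp 2 fun j => ψ j x) - (WithLp.toLp 2 fun j => ψ j y)‖ ^ 2 := by gcongr
    _ = _ := by rw [EuclideanSpace.norm_sq_eq]; simp

section UnitCube

variable {ι κ : Type*} [Fintype ι] [Fintype κ] {ψ : κ → (ι → ℝ) → ℂ}

/-- Poincaré inequality for the square root of the density on the unit cube. -/
lemma setLIntegral_sqrt_familyDensity_sub_sq_le (hψ : ∀ j, ContDiff ℝ 1 (ψ j)) {a : ℝ}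
    (ha : 0 < a) (hmass : ∫ x in Set.Icc 0 1, familyDensity ψ x = a ^ 2) :
    ∫⁻ x in Set.Icc 0 1, ENNReal.ofReal ((√(familyDensity ψ x) - a) ^ 2) ≤
      2 ^ Fintype.card ι * ∫⁻ x in Set.Icc 0 1, ENNReal.ofReal (energyDensity ψ x) := by
  set I : Set (ι → ℝ) := Set.Icc 0 1 with hI
  have hIm : MeasurableSet I := measurableSet_Icc
  have hIc : IsCompact I := isCompact_Icc
  have hIv : volume I = 1 := by simp [hI, Real.volume_Icc_pi]
  have hρc := (contDiff_familyDensity hψ).continuous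
  have hFint : ∀ {F : (ι → ℝ) → ℝ}, Continuous F → IntegrableOn F I := fun hF =>
    hF.continuousOn.integrableOn_compact hIc
  have hone : ∀ c : ℝ, ∫ _ in I, c = c := fun c => by simp [Measure.real, hIv]
  have hpt : ∀ x, ENNReal.ofReal ((√(familyDensity ψ x) - a) ^ 2) ≤
      ∑ j, ∫⁻ y in I, ‖ψ j x - ψ j y‖ₑ ^ 2 := by
    intro x
    set u := √(familyDensity ψ x) with hu
    have hc1 : Continuous fun y => ∑ j, ‖ψ j x - ψ j y‖ ^ 2 :=
      continuous_finsetSum _ fun j _ => ((continuous_const.sub (hψ j).continuous).norm).pow 2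
    have hc2 : Continuous fun y => (1 - u / a) * familyDensity ψ y := continuous_const.mul hρc
    have hreal : (u - a) ^ 2 ≤ ∫ y in I, ∑ j, ‖ψ j x - ψ j y‖ ^ 2 := by
      calc (u - a) ^ 2 = ∫ y in I, ((u ^ 2 - u * a) + (1 - u / a) * familyDensity ψ y) := by
            rw [integral_add (hFint continuous_const) (hFint hc2), hone,
              integral_const_mul, hmass]
            field_simp
            ring
        _ ≤ _ := by
            refine integral_mono (hFint (continuous_const.add hc2))
              (hFint hc1) fun y => ?_
            refine le_trans ?_ (sqrt_familyDensity_sub_sq_le ψ x y)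
            have hw2 := Real.sq_sqrt (familyDensity_nonneg ψ y)
            have hw0 := Real.sqrt_nonneg (familyDensity ψ y)
            have hu0 : 0 ≤ u := Real.sqrt_nonneg _
            simp only [← hu]
            set w := √(familyDensity ψ y)
            rw [← hw2, ← sub_nonneg]
            have : (u - w) ^ 2 - (u ^ 2 - u * a + (1 - u / a) * w ^ 2) = u / a * (w - a) ^ 2 := by
              field_simp
              ring
            rw [this]
            positivity
    calc ENNReal.ofReal ((u - a) ^ 2)
        ≤ ENNReal.ofReal (∫ y in I, ∑ j, ‖ψ j x - ψ j y‖ ^ 2) := ENNReal.ofReal_le_ofReal hreal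
      _ = ∫⁻ y in I, ENNReal.ofReal (∑ j, ‖ψ j x - ψ j y‖ ^ 2) :=
          ofReal_integral_eq_lintegral_ofReal (hFint hc1)
            (Filter.Eventually.of_forall fun y => Finset.sum_nonneg fun _ _ => by positivity)
      _ = ∫⁻ y in I, ∑ j, ‖ψ j x - ψ j y‖ₑ ^ 2 := by
          refine lintegral_congr fun y => ?_
          rw [ENNReal.ofReal_sum_of_nonneg fun _ _ => by positivity]
          simp_rw [enorm_sq_eq_ofReal]
      _ = _ := lintegral_finsetSum _ fun j _ =>
          (continuous_const.sub (hψ j).continuous).enorm.measurable.pow_const 2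
  have hdiam : ∀ x ∈ I, ∀ y ∈ I, ‖x - y‖ₑ ≤ 1 := by
    intro x hx y hy
    rw [← ofReal_norm, ENNReal.ofReal_le_one, pi_norm_le_iff_of_nonneg zero_le_one]
    intro i
    have h1 := hx.1 i
    have h2 := hx.2 i
    have h3 := hy.1 i
    have h4 := hy.2 i
    simp only [Pi.zero_apply, Pi.one_apply] at h1 h2 h3 h4
    rw [Pi.sub_apply, Real.norm_eq_abs, abs_le]
    constructor <;> linarith
  calc ∫⁻ x in I, ENNReal.ofReal ((√(familyDensity ψ x) - a) ^ 2)
      ≤ ∫⁻ x in I, ∑ j, ∫⁻ y in I, ‖ψ j x - ψ j y‖ₑ ^ 2 := lintegral_mono hpt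
    _ = ∑ j, ∫⁻ x in I, ∫⁻ y in I, ‖ψ j x - ψ j y‖ₑ ^ 2 := by
        refine lintegral_finsetSum _ fun j _ => ?_
        have hm : Measurable fun p : (ι → ℝ) × (ι → ℝ) => ‖ψ j p.1 - ψ j p.2‖ₑ ^ 2 :=
          ((((hψ j).continuous.comp continuous_fst).sub
            ((hψ j).continuous.comp continuous_snd)).enorm.measurable).pow_const 2
        exact hm.lintegral_prod_right'
    _ ≤ ∑ j, 2 ^ Fintype.card ι * ∫⁻ x in I, ‖fderiv ℝ (ψ j) x‖ₑ ^ 2 := by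
        refine Finset.sum_le_sum fun j _ => ?_
        have h := lintegral_enorm_sub_sq_le volume (convex_Icc (0 : ι → ℝ) 1) hIm hdiam (hψ j)
        rwa [← hI, hIv, Module.finrank_fintype_fun_eq_card, one_pow, one_mul, mul_one] at h
    _ = 2 ^ Fintype.card ι * ∫⁻ x in I, ENNReal.ofReal (energyDensity ψ x) := by
        rw [← Finset.mul_sum, ← lintegral_finsetSum _ fun j _ =>
          ((hψ j).continuous_fderiv one_ne_zero).enorm.measurable.pow_const 2]
        congr 1
        refine lintegral_congr fun x => ?_
        rw [energyDensity, ENNReal.ofReal_sum_of_nonneg fun _ _ => by positivity]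
        simp_rw [enorm_sq_eq_ofReal]

/-- The kinetic inequality on the unit cube. -/
lemma exists_unit_cube_inequality {D : ℕ} (hD : 0 < D) : ∃ C : ℝ, 0 < C ∧
    ∀ {ι κ : Type*} [Fintype ι] [Fintype κ], Fintype.card ι = D →
    ∀ {ψ : κ → (ι → ℝ) → ℂ}, (∀ j, ContDiff ℝ 1 (ψ j)) → ∀ {a : ℝ}, 0 < a →
    ∫ x in Set.Icc 0 1, familyDensity ψ x = a ^ 2 →
    ∫⁻ x in Set.Icc 0 1,
        ENNReal.ofReal (max (√(familyDensity ψ x) - a) 0 ^ (2 + 4 / (D : ℝ))) ≤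
      ENNReal.ofReal (C * a ^ (4 / (D : ℝ))) *
        ∫⁻ x in Set.Icc 0 1, ENNReal.ofReal (energyDensity ψ x) := by
  obtain ⟨C, hC, hhigh⟩ := exists_setLIntegral_high_density_le hD
  have hD' : (0 : ℝ) < D := by exact_mod_cast hD
  set q : ℝ := 4 / (D : ℝ) with hq
  have hq0 : 0 < q := by positivity
  refine ⟨C + 3 ^ q * 2 ^ D, by positivity, ?_⟩
  intro ι κ _ _ hcard ψ hψ a ha hmass
  have hρc := (contDiff_familyDensity hψ).continuous
  have hmass' : ∫⁻ x in Set.Icc 0 1, ENNReal.ofReal (familyDensity ψ x) =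
      ENNReal.ofReal (a ^ 2) := by
    rw [← hmass, ofReal_integral_eq_lintegral_ofReal
      (hρc.continuousOn.integrableOn_compact isCompact_Icc)
      (Filter.Eventually.of_forall (familyDensity_nonneg ψ))]
  have hhm : MeasurableSet {x | 16 * a ^ 2 ≤ familyDensity ψ x} :=
    (isClosed_le continuous_const hρc).measurableSet
  have hpt : ∀ x, ENNReal.ofReal (max (√(familyDensity ψ x) - a) 0 ^ (2 + q)) ≤
      {x | 16 * a ^ 2 ≤ familyDensity ψ x}.indicator
        (fun x => ENNReal.ofReal (√(familyDensity ψ x) ^ (2 + q))) x +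
      ENNReal.ofReal ((3 * a) ^ q) * ENNReal.ofReal ((√(familyDensity ψ x) - a) ^ 2) := by
    intro x
    by_cases hx : x ∈ {x | 16 * a ^ 2 ≤ familyDensity ψ x}
    · rw [Set.indicator_of_mem hx]
      refine le_add_right (ENNReal.ofReal_le_ofReal ?_)
      gcongr
      exact max_le (by linarith) (Real.sqrt_nonneg _)
    · rw [Set.indicator_of_notMem hx, zero_add, ← ENNReal.ofReal_mul (by positivity)]
      refine ENNReal.ofReal_le_ofReal ?_
      have hx' : familyDensity ψ x < 16 * a ^ 2 := not_le.1 hx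
      have hs : √(familyDensity ψ x) ≤ 4 * a := by
        rw [Real.sqrt_le_left (by positivity)]
        nlinarith
      rcases le_or_gt (√(familyDensity ψ x) - a) 0 with h | h
      · rw [max_eq_right h, Real.zero_rpow (by positivity)]
        positivity
      · rw [max_eq_left h.le, Real.rpow_add h, Real.rpow_two, mul_comm]
        gcongr
        linarith
  calc ∫⁻ x in Set.Icc 0 1, ENNReal.ofReal (max (√(familyDensity ψ x) - a) 0 ^ (2 + q))
      ≤ _ := lintegral_mono hpt
    _ = (∫⁻ x in {x | 16 * a ^ 2 ≤ familyDensity ψ x} ∩ Set.Icc 0 1,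
          ENNReal.ofReal (√(familyDensity ψ x) ^ (2 + q))) + ENNReal.ofReal ((3 * a) ^ q) *
          ∫⁻ x in Set.Icc 0 1, ENNReal.ofReal ((√(familyDensity ψ x) - a) ^ 2) := by
        rw [lintegral_add_right, setLIntegral_indicator hhm,
          lintegral_const_mul' _ _ ENNReal.ofReal_ne_top]
        exact (((hρc.sqrt.sub continuous_const).pow 2).measurable.ennreal_ofReal).const_mul _
    _ ≤ ENNReal.ofReal (C * a ^ q) *
          (∫⁻ x in Set.Icc 0 1, ENNReal.ofReal (energyDensity ψ x)) +
        ENNReal.ofReal ((3 * a) ^ q) *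
          (2 ^ D * ∫⁻ x in Set.Icc 0 1, ENNReal.ofReal (energyDensity ψ x)) := by
        gcongr
        · exact hhigh hcard hψ ha hmass'
        · rw [← hcard]
          exact setLIntegral_sqrt_familyDensity_sub_sq_le hψ ha hmass
    _ = _ := by
        rw [show (2 : ENNReal) ^ D = ENNReal.ofReal (2 ^ D) by
            rw [ENNReal.ofReal_pow zero_le_two, ENNReal.ofReal_ofNat], ← mul_assoc,
          ← ENNReal.ofReal_mul (by positivity), ← add_mul,
          ← ENNReal.ofReal_add (by positivity) (by positivity),
          Real.mul_rpow (by positivity) ha.le]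
        congr 2
        ring

end UnitCube

lemma IsometryEquiv.eq_toRealLinearIsometryEquiv_add {E F : Type*} [NormedAddCommGroup E]
    [NormedSpace ℝ E] [NormedAddCommGroup F] [NormedSpace ℝ F] (f : E ≃ᵢ F) :
    (f : E → F) = fun x => f.toRealLinearIsometryEquiv x + f 0 := by
  ext x
  simp [IsometryEquiv.toRealLinearIsometryEquiv_apply]

lemma IsometryEquiv.measurePreserving_volume {E : Type*} [NormedAddCommGroup E]
    [InnerProductSpace ℝ E] [FiniteDimensional ℝ E] [MeasurableSpace E] [BorelSpace E]
    (f : E ≃ᵢ E) : MeasurePreserving f := by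
  rw [f.eq_toRealLinearIsometryEquiv_add]
  exact (measurePreserving_add_right volume (f 0)).comp
    f.toRealLinearIsometryEquiv.measurePreserving

lemma IsometryEquiv.contDiff {E F : Type*} [NormedAddCommGroup E] [NormedSpace ℝ E]
    [NormedAddCommGroup F] [NormedSpace ℝ F] (f : E ≃ᵢ F) {n : WithTop ℕ∞} :
    ContDiff ℝ n f := by
  rw [f.eq_toRealLinearIsometryEquiv_add]
  exact f.toRealLinearIsometryEquiv.toContinuousLinearEquiv.contDiff.add contDiff_const

/-- A cube of side length `L` is parametrized by the unit cube through a similarity. -/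
lemma IsCube.exists_parametrization {d : ℕ} {Q : Set (EuclideanSpace ℝ (Fin d))}
    (hQ : IsCube d Q) : ∃ L : ℝ, 0 < L ∧ ∃ g : (Fin d → ℝ) → EuclideanSpace ℝ (Fin d),
      ContDiff ℝ 1 g ∧ (∀ x, ‖fderiv ℝ g x‖ ≤ √d * L) ∧ MeasurableEmbedding g ∧
      volume.restrict Q =
        ENNReal.ofReal (L ^ d) • Measure.map g (volume.restrict (Set.Icc 0 1)) := by
  obtain ⟨L, hL, f, rfl⟩ := hQ
  set g : (Fin d → ℝ) → EuclideanSpace ℝ (Fin d) := fun x => f (WithLp.toLp 2 (L • x)) with hg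
  have hemb : MeasurableEmbedding g :=
    f.toHomeomorph.measurableEmbedding.comp
      ((MeasurableEquiv.toLp 2 (Fin d → ℝ)).measurableEmbedding.comp
        (Homeomorph.smulOfNeZero L hL.ne').measurableEmbedding)
  have hmap : Measure.map g volume = ENNReal.ofReal ((L ^ d)⁻¹) • volume := by
    have h1 := (f.measurePreserving_volume.comp (PiLp.volume_preserving_toLp (Fin d)))
    have : g = (f ∘ WithLp.toLp 2) ∘ (L • ·) := rfl
    rw [this, ← Measure.map_map h1.measurable (measurable_const_smul L),
      Measure.map_addHaar_smul _ hL.ne', Measure.map_smul, h1.map_eq, Module.finrank_fin_fun,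
      abs_of_pos (by positivity)]
  refine ⟨L, hL, g, ?_, fun x => ?_, hemb, ?_⟩
  · exact f.contDiff.comp ((PiLp.contDiff_toLp).comp (contDiff_const_smul L))
  · refine (norm_fderiv_le_of_lipschitz ℝ (C := (√d * L).toNNReal) ?_).trans_eq
      (Real.coe_toNNReal _ (by positivity))
    refine LipschitzWith.of_dist_le_mul fun x y => ?_
    have h2 := (PiLp.lipschitzWith_toLp 2 (fun _ : Fin d => ℝ)).dist_le_mul (L • x) (L • y)
    simp only [hg, f.dist_eq]
    refine h2.trans_eq ?_
    rw [dist_smul₀, Real.norm_of_nonneg hL.le, Real.coe_toNNReal _ (by positivity), mul_assoc,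
      Real.sqrt_eq_rpow]
    simp
  · have hpre : g ⁻¹' (f '' {x | ∀ m, x m ∈ Set.Ioo 0 L}) =
        Set.univ.pi fun m : Fin d => Set.Ioo ((0 : Fin d → ℝ) m) ((1 : Fin d → ℝ) m) := by
      ext x
      simp [hg, Set.mem_pi, f.injective.mem_set_image, mul_pos_iff_of_pos_left hL,
        mul_lt_iff_lt_one_right hL]
    have h3 : volume = ENNReal.ofReal (L ^ d) • Measure.map g volume := by
      rw [hmap, smul_smul, ← ENNReal.ofReal_mul (by positivity),
        mul_inv_cancel₀ (by positivity), ENNReal.ofReal_one, one_smul]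
    conv_lhs => rw [h3]
    rw [Measure.restrict_smul, hemb.restrict_map, hpre, volume_pi,
      Measure.restrict_congr_set Measure.univ_pi_Ioo_ae_eq_Icc]

/-- The operator norm of a linear functional is at most its Hilbert–Schmidt norm. -/
lemma norm_sq_le_sum_norm_apply_single_sq {d : ℕ} {F : Type*} [NormedAddCommGroup F]
    [NormedSpace ℝ F] (T : EuclideanSpace ℝ (Fin d) →L[ℝ] F) :
    ‖T‖ ^ 2 ≤ ∑ m, ‖T (EuclideanSpace.single m 1)‖ ^ 2 := by
  refine (Real.le_sqrt (norm_nonneg _) (Finset.sum_nonneg fun m _ => by positivity)).1 ?_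
  refine T.opNorm_le_bound (Real.sqrt_nonneg _) fun x => ?_
  have hx : x = ∑ m, x m • EuclideanSpace.single m (1 : ℝ) := by
    simpa using ((EuclideanSpace.basisFun (Fin d) ℝ).sum_repr x).symm
  calc ‖T x‖ = ‖∑ m, x m • T (EuclideanSpace.single m 1)‖ := by
        conv_lhs => rw [hx]
        simp
    _ ≤ ∑ m, ‖T (EuclideanSpace.single m 1)‖ * ‖x m‖ := by
        refine (norm_sum_le _ _).trans_eq (Finset.sum_congr rfl fun m _ => ?_)
        rw [norm_smul, mul_comm]
    _ ≤ _ := by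
        rw [EuclideanSpace.norm_eq]
        exact Real.sum_mul_le_sqrt_mul_sqrt _ _ _

/-- **Theorem (Neumann Lieb–Thirring inequality on a cube).** For every `d ≥ 1` there is a
`C_d' > 0` such that for every cube `Q ⊂ ℝ^d`, every `N ≥ 1` and all smooth
`φ₁,…,φ_N : ℝ^d → ℂ` with `∫_Q ρ > 0`, where `ρ := ∑_j |φ_j|²`,
`∑_j ∫_Q |∇φ_j|² ≥ C_d' (∫_Q ρ)^{-2/d} ∫_Q [ρ^{1/2} − ((∫_Q ρ)/|Q|)^{1/2}]₊^{2(d+2)/d}`. -/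
theorem neumann_lieb_thirring_cube (d : ℕ) (hd : 1 ≤ d) :
    ∃ C : ℝ, 0 < C ∧
      ∀ Q : Set (EuclideanSpace ℝ (Fin d)), IsCube d Q →
      ∀ N : ℕ, 1 ≤ N →
      ∀ φ : Fin N → EuclideanSpace ℝ (Fin d) → ℂ, (∀ j, ContDiff ℝ (⊤ : ℕ∞) (φ j)) →
      0 < (∫ x in Q, ∑ j : Fin N, ‖φ j x‖ ^ 2) →
      ENNReal.ofReal (C * (∫ x in Q, ∑ j : Fin N, ‖φ j x‖ ^ 2) ^ (-(2 : ℝ) / (d : ℝ)) *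
          ∫ x in Q, (max (Real.sqrt (∑ j : Fin N, ‖φ j x‖ ^ 2) -
              Real.sqrt ((∫ y in Q, ∑ j : Fin N, ‖φ j y‖ ^ 2) / (volume Q).toReal)) 0) ^
            (2 * ((d : ℝ) + 2) / (d : ℝ))) ≤
        ∑ j : Fin N, ∫⁻ x in Q, ENNReal.ofReal
          (∑ m : Fin d, ‖fderiv ℝ (φ j) x (EuclideanSpace.single m (1 : ℝ))‖ ^ 2) := by
  have hd0 : (0 : ℝ) < d := by exact_mod_cast hd
  obtain ⟨C, hC, hunit⟩ := exists_unit_cube_inequality (D := d) hd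
  refine ⟨1 / (C * d), by positivity, fun Q hQ N _ φ hφ hM => ?_⟩
  obtain ⟨L, hL, g, hg, hgL, hemb, hres⟩ := hQ.exists_parametrization
  replace hφ : ∀ j, ContDiff ℝ 1 (φ j) := fun j => (hφ j).of_le (by exact_mod_cast le_top)
  have hψ : ∀ j, ContDiff ℝ 1 (φ j ∘ g) := fun j => (hφ j).comp hg
  have hvol : (volume Q).toReal = L ^ d := by
    rw [← Measure.restrict_apply_univ, hres, Measure.smul_apply,
      Measure.map_apply hemb.measurable .univ, Set.preimage_univ, Measure.restrict_apply_univ,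
      Real.volume_Icc_pi]
    simp [hL.le]
  have hFint : ∀ F : EuclideanSpace ℝ (Fin d) → ℝ,
      ∫ x in Q, F x = L ^ d * ∫ x in Set.Icc 0 1, F (g x) := fun F => by
    rw [hres, integral_smul_measure, hemb.integral_map, ENNReal.toReal_ofReal (by positivity),
      smul_eq_mul]
  have hlint : ∀ F : EuclideanSpace ℝ (Fin d) → ENNReal,
      ∫⁻ x in Q, F x = ENNReal.ofReal (L ^ d) * ∫⁻ x in Set.Icc 0 1, F (g x) := fun F => by
    rw [hres, lintegral_smul_measure, hemb.lintegral_map, smul_eq_mul]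
  rw [hvol]
  set M := ∫ x in Q, ∑ j, ‖φ j x‖ ^ 2 with hMdef
  set a := √(M / L ^ d) with ha
  have ha0 : 0 < a := Real.sqrt_pos.2 (by positivity)
  have haM : M = L ^ d * a ^ 2 := by
    rw [ha, Real.sq_sqrt (by positivity), mul_div_cancel₀ _ (by positivity)]
  have hmean : ∫ x in Set.Icc 0 1, familyDensity (fun j => φ j ∘ g) x = a ^ 2 := by
    have := hFint (familyDensity φ)
    exact (mul_left_cancel₀ (by positivity) (haM.symm.trans this)).symm
  have hexp : 2 * ((d : ℝ) + 2) / d = 2 + 4 / d := by field_simp; ring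
  have hpow : M ^ (-(2 : ℝ) / d) = (L ^ 2 * a ^ (4 / (d : ℝ)))⁻¹ := by
    rw [haM, neg_div, Real.rpow_neg (by positivity), Real.mul_rpow (by positivity) (by positivity),
      ← Real.rpow_natCast L d, ← Real.rpow_mul hL.le, ← Real.rpow_natCast a 2,
      ← Real.rpow_mul ha0.le, mul_div_cancel₀ _ hd0.ne', Real.rpow_ofNat]
    congr 3
    push_cast
    ring
  set S : EuclideanSpace ℝ (Fin d) → ℝ := fun x =>
    ∑ j, ∑ m, ‖fderiv ℝ (φ j) x (EuclideanSpace.single m (1 : ℝ))‖ ^ 2 with hS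
  have henergy : ∀ x, energyDensity (fun j => φ j ∘ g) x ≤ d * L ^ 2 * S (g x) := fun x => by
    rw [energyDensity, hS, Finset.mul_sum]
    refine Finset.sum_le_sum fun j _ => ?_
    rw [fderiv_comp x ((hφ j).differentiable one_ne_zero _) (hg.differentiable one_ne_zero _)]
    calc ‖(fderiv ℝ (φ j) (g x)).comp (fderiv ℝ g x)‖ ^ 2
        ≤ (‖fderiv ℝ (φ j) (g x)‖ * (√d * L)) ^ 2 := by
          gcongr
          refine (ContinuousLinearMap.opNorm_comp_le _ _).trans ?_
          gcongr
          exact hgL x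
      _ = d * L ^ 2 * ‖fderiv ℝ (φ j) (g x)‖ ^ 2 := by
          rw [mul_pow, mul_pow, Real.sq_sqrt hd0.le]
          ring
      _ ≤ _ := by
          gcongr
          exact norm_sq_le_sum_norm_apply_single_sq _
  have hrhs : ∑ j, ∫⁻ x in Q, ENNReal.ofReal
      (∑ m, ‖fderiv ℝ (φ j) x (EuclideanSpace.single m (1 : ℝ))‖ ^ 2) =
      ENNReal.ofReal (L ^ d) * ∫⁻ x in Set.Icc 0 1, ENNReal.ofReal (S (g x)) := by
    rw [← lintegral_finsetSum, ← hlint fun x => ENNReal.ofReal (S x)]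
    · refine lintegral_congr fun x => ?_
      rw [hS, ENNReal.ofReal_sum_of_nonneg fun j _ => Finset.sum_nonneg fun m _ => by positivity]
    · intro j _
      have := (hφ j).continuous_fderiv one_ne_zero
      exact ENNReal.measurable_ofReal.comp (Continuous.measurable (by fun_prop))
  rw [hrhs, hFint, hexp, hpow]
  set G : (Fin d → ℝ) → ℝ := fun x =>
    max (√(familyDensity (fun j => φ j ∘ g) x) - a) 0 ^ (2 + 4 / (d : ℝ)) with hG
  have hGcont : Continuous G := by
    have := (contDiff_familyDensity hψ).continuous
    exact Continuous.rpow_const (by fun_prop) fun x => .inr (by positivity)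
  have hGle : ENNReal.ofReal (∫ x in Set.Icc 0 1, G x) ≤
      ∫⁻ x in Set.Icc 0 1, ENNReal.ofReal (G x) := by
    rw [integral_eq_lintegral_of_nonneg_ae (.of_forall fun x => by positivity)
      hGcont.aestronglyMeasurable]
    exact ENNReal.ofReal_toReal_le
  calc ENNReal.ofReal (1 / (C * d) * (L ^ 2 * a ^ (4 / (d : ℝ)))⁻¹ *
        (L ^ d * ∫ x in Set.Icc 0 1, G x))
      = ENNReal.ofReal (1 / (C * d) * (L ^ 2 * a ^ (4 / (d : ℝ)))⁻¹ * L ^ d) *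
          ENNReal.ofReal (∫ x in Set.Icc 0 1, G x) := by
        rw [← mul_assoc, ENNReal.ofReal_mul (by positivity)]
    _ ≤ ENNReal.ofReal (1 / (C * d) * (L ^ 2 * a ^ (4 / (d : ℝ)))⁻¹ * L ^ d) *
          (ENNReal.ofReal (C * a ^ (4 / (d : ℝ))) *
            (ENNReal.ofReal (d * L ^ 2) *
              ∫⁻ x in Set.Icc 0 1, ENNReal.ofReal (S (g x)))) := by
        gcongr
        refine hGle.trans ((hunit (Fintype.card_fin d) hψ ha0 hmean).trans ?_)
        gcongr
        rw [← lintegral_const_mul' _ _ ENNReal.ofReal_ne_top]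
        refine lintegral_mono fun x => ?_
        rw [← ENNReal.ofReal_mul (by positivity)]
        exact ENNReal.ofReal_le_ofReal (henergy x)
    _ = _ := by
        rw [← mul_assoc, ← mul_assoc, ← ENNReal.ofReal_mul (by positivity),
          ← ENNReal.ofReal_mul (by positivity)]
        congr 2
        field_simp

end
end

section
/- For every dimension d ≥ 1 there exists a constant C_d' > 0, depending only on d, such that for every cube Q ⊂ ℝ^d with volume |Q|, every N ≥ 1, and all smooth functions φ₁,…,φ_N : ℝ^d → ℂ whose restrictions to Q are orthonormal in L²(Q) (∫_Q φ_j(x) conj(φ_k(x)) dx = δ_{jk}): ∑_{j=1}^N ∫_Q |∇φ_j|² dx ≥ C_d' · ∫_Q [ρ(x)^{1/2} − |Q|^{−1/2}]₊^{2(d+2)/d} dx, where ρ(x) := ∑_{j=1}^N |φ_j(x)|². -/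
open MeasureTheory

noncomputable section

namespace NeumannCube

open Real Set

/-- The uniform probability measure on the open unit cube of `ℝ^d`. -/
def cubeMeasure (d : ℕ) : Measure (Fin d → ℝ) :=
  Measure.pi fun _ => volume.restrict (Ioo (0 : ℝ) 1)

/-- The `L²`-normalised Neumann eigenfunctions of the unit interval. -/
def cosMode (a : ℕ) (t : ℝ) : ℝ := if a = 0 then 1 else √2 * cos (π * a * t)

/-- The `L²`-normalised Dirichlet eigenfunctions of the unit interval. -/
def sinMode (a : ℕ) (t : ℝ) : ℝ := √2 * sin (π * a * t)

/-- The tensor product of the functions `e i (k i)` of one variable. -/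
def modeProd {d : ℕ} (e : Fin d → ℕ → ℝ → ℝ) (k : Fin d → ℕ) (x : Fin d → ℝ) : ℝ :=
  ∏ i, e i (k i) (x i)

lemma integral_cos_pi_int (n : ℤ) :
    ∫ t in (0 : ℝ)..1, cos (π * n * t) = if n = 0 then 1 else 0 := by
  split_ifs with h
  · simp [h]
  · have hn : π * (n : ℝ) ≠ 0 := mul_ne_zero pi_ne_zero (by exact_mod_cast h)
    rw [intervalIntegral.integral_comp_mul_left _ hn, integral_cos]
    have : sin (π * n) = 0 := by rw [mul_comm]; exact sin_int_mul_pi n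
    simp [this]

lemma integral_cosMode_mul (a b : ℕ) :
    ∫ t in Ioo (0 : ℝ) 1, cosMode a t * cosMode b t = if a = b then 1 else 0 := by
  rw [← integral_Ioc_eq_integral_Ioo, ← intervalIntegral.integral_of_le zero_le_one]
  have key (a b : ℕ) : ∫ t in (0 : ℝ)..1, (√2 * cos (π * a * t)) * (√2 * cos (π * b * t)) =
      (if (a : ℤ) - b = 0 then 1 else 0) + if (a : ℤ) + b = 0 then 1 else 0 := by
    rw [← integral_cos_pi_int, ← integral_cos_pi_int, ← intervalIntegral.integral_add]
    · congr 1 with t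
      have h1 : π * ((a - b : ℤ) : ℝ) * t = π * a * t - π * b * t := by push_cast; ring
      have h2 : π * ((a + b : ℤ) : ℝ) * t = π * a * t + π * b * t := by push_cast; ring
      rw [h1, h2, cos_sub, cos_add]
      linear_combination (cos (π * a * t) * cos (π * b * t)) * mul_self_sqrt (zero_le_two (α := ℝ))
    all_goals exact (by fun_prop : Continuous _).intervalIntegrable _ _
  have key0 (b : ℕ) (hb : b ≠ 0) : ∫ t in (0 : ℝ)..1, √2 * cos (π * b * t) = 0 := by
    rw [intervalIntegral.integral_const_mul]
    have := integral_cos_pi_int b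
    simp_all
  rcases eq_or_ne a 0 with rfl | ha <;> rcases eq_or_ne b 0 with rfl | hb
  · simp [cosMode]
  · simpa [cosMode, hb, hb.symm] using key0 b hb
  · simpa [cosMode, ha] using key0 a ha
  · simp only [cosMode, ha, hb, if_false]
    rw [key]
    have : (a : ℤ) + b ≠ 0 := by omega
    simp [this, sub_eq_zero]

lemma integral_sinMode_mul (a b : ℕ) (ha : a ≠ 0) :
    ∫ t in Ioo (0 : ℝ) 1, sinMode a t * sinMode b t = if a = b then 1 else 0 := by
  rw [← integral_Ioc_eq_integral_Ioo, ← intervalIntegral.integral_of_le zero_le_one]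
  have key : ∫ t in (0 : ℝ)..1, sinMode a t * sinMode b t =
      (if (a : ℤ) - b = 0 then 1 else 0) - if (a : ℤ) + b = 0 then 1 else 0 := by
    rw [← integral_cos_pi_int, ← integral_cos_pi_int, ← intervalIntegral.integral_sub]
    · congr 1 with t
      have h1 : π * ((a - b : ℤ) : ℝ) * t = π * a * t - π * b * t := by push_cast; ring
      have h2 : π * ((a + b : ℤ) : ℝ) * t = π * a * t + π * b * t := by push_cast; ring
      rw [h1, h2, cos_sub, cos_add, sinMode, sinMode]
      linear_combination (sin (π * a * t) * sin (π * b * t)) * mul_self_sqrt (zero_le_two (α := ℝ))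
    all_goals exact (by fun_prop : Continuous _).intervalIntegrable _ _
  rw [key]
  have : (a : ℤ) + b ≠ 0 := by omega
  simp [this, sub_eq_zero]

lemma continuous_cosMode (a : ℕ) : Continuous (cosMode a) := by
  unfold cosMode
  split_ifs <;> fun_prop

lemma continuous_sinMode (a : ℕ) : Continuous (sinMode a) := by
  unfold sinMode
  fun_prop

variable {d : ℕ}

instance : IsProbabilityMeasure (volume.restrict (Ioo (0 : ℝ) 1)) := ⟨by simp⟩

instance : IsProbabilityMeasure (cubeMeasure d) := by
  unfold cubeMeasure
  infer_instance

lemma cubeMeasure_eq_restrict_Ioo :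
    cubeMeasure d = volume.restrict (univ.pi fun _ => Ioo (0 : ℝ) 1) := by
  rw [cubeMeasure, volume_pi, Measure.restrict_pi_pi]

lemma cubeMeasure_eq_restrict_Icc : cubeMeasure d = volume.restrict (Icc 0 1) := by
  rw [cubeMeasure_eq_restrict_Ioo]
  exact Measure.restrict_congr_set Measure.univ_pi_Ioo_ae_eq_Icc

lemma ae_mem_Icc : ∀ᵐ x ∂cubeMeasure d, x ∈ Icc (0 : Fin d → ℝ) 1 := by
  rw [cubeMeasure_eq_restrict_Icc]
  exact ae_restrict_mem measurableSet_Icc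

lemma memLp_of_continuous {f : (Fin d → ℝ) → ℂ} (hf : Continuous f) :
    MemLp f 2 (cubeMeasure d) := by
  obtain ⟨C, hC⟩ := (isCompact_Icc (a := (0 : Fin d → ℝ)) (b := 1)).exists_bound_of_continuousOn
    hf.continuousOn
  exact MemLp.of_bound hf.aestronglyMeasurable C (ae_mem_Icc.mono hC)

lemma integrable_of_continuous {f : (Fin d → ℝ) → ℂ} (hf : Continuous f) :
    Integrable f (cubeMeasure d) :=
  (memLp_of_continuous hf).integrable (by norm_num)

/-- The class in `L²` of the unit cube of a continuous function. -/
def toL2 (f : (Fin d → ℝ) → ℂ) (hf : Continuous f) : Lp ℂ 2 (cubeMeasure d) :=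
  (memLp_of_continuous hf).toLp f

lemma inner_toL2 {f g : (Fin d → ℝ) → ℂ} (hf : Continuous f) (hg : Continuous g) :
    inner ℂ (toL2 f hf) (toL2 g hg) = ∫ x, g x * starRingEnd ℂ (f x) ∂cubeMeasure d := by
  rw [L2.inner_def]
  refine integral_congr_ae ?_
  filter_upwards [(memLp_of_continuous hf).coeFn_toLp, (memLp_of_continuous hg).coeFn_toLp]
    with x h1 h2
  rw [toL2, toL2, h1, h2]
  simp

lemma lintegral_norm_sq_toL2 {f : (Fin d → ℝ) → ℂ} (hf : Continuous f) :
    ∫⁻ x, ENNReal.ofReal (‖f x‖ ^ 2) ∂cubeMeasure d = ENNReal.ofReal (‖toL2 f hf‖ ^ 2) := by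
  rw [← ofReal_integral_eq_lintegral_ofReal]
  · congr 1
    have h := inner_toL2 hf hf
    simp only [inner_self_eq_norm_sq_to_K, RCLike.mul_conj] at h
    have h2 : ∫ x, ((‖f x‖ : ℂ)) ^ 2 ∂cubeMeasure d =
        ((∫ x, ‖f x‖ ^ 2 ∂cubeMeasure d : ℝ) : ℂ) := by
      rw [← integral_complex_ofReal]
      simp
    have h3 := h.trans h2
    exact (Complex.ofReal_injective ((Complex.ofReal_pow _ _).trans h3)).symm
  · exact (memLp_of_continuous hf).integrable_norm_pow (by norm_num)
  · exact Filter.Eventually.of_forall fun x => by positivity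

lemma continuous_modeProd {e : Fin d → ℕ → ℝ → ℝ} (he : ∀ i a, Continuous (e i a))
    (k : Fin d → ℕ) : Continuous fun x => (modeProd e k x : ℂ) := by
  unfold modeProd
  refine Complex.continuous_ofReal.comp (continuous_finsetProd _ fun i _ => ?_)
  exact (he i (k i)).comp (continuous_apply i)

lemma orthonormal_modeProd {e : Fin d → ℕ → ℝ → ℝ} (he : ∀ i a, Continuous (e i a))
    (p : (Fin d → ℕ) → Prop)
    (ho : ∀ k, p k → ∀ i b, ∫ t in Ioo (0 : ℝ) 1, e i (k i) t * e i b t = if k i = b then 1 else 0) :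
    Orthonormal ℂ fun k : {k // p k} => toL2 _ (continuous_modeProd he k.1) := by
  rw [orthonormal_iff_ite]
  rintro ⟨k, hk⟩ ⟨l, hl⟩
  rw [inner_toL2]
  have h1 (x : Fin d → ℝ) : (modeProd e l x : ℂ) * starRingEnd ℂ (modeProd e k x : ℂ) =
      ((∏ i, (e i (k i) (x i) * e i (l i) (x i)) : ℝ) : ℂ) := by
    rw [Complex.conj_ofReal, Finset.prod_mul_distrib, ← Complex.ofReal_mul, mul_comm]
    rfl
  simp_rw [h1]
  rw [integral_complex_ofReal, cubeMeasure,
    integral_fintype_prod_eq_prod fun i t => e i (k i) t * e i (l i) t]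
  simp_rw [ho k hk]
  simp only [Subtype.mk.injEq]
  split_ifs with h
  · simp [h]
  · obtain ⟨i, hi⟩ := Function.ne_iff.1 h
    rw [Finset.prod_eq_zero (Finset.mem_univ i) (by simp [hi])]
    simp

/-- The functions `cosProd k`, `k ∈ ℕ^d`, are the Neumann eigenfunctions of the unit cube. -/
abbrev cosProd (k : Fin d → ℕ) : (Fin d → ℝ) → ℝ := modeProd (fun _ => cosMode) k

/-- The continuous functions on the closed unit cube. -/
abbrev CubeMap (d : ℕ) := C(Icc (0 : Fin d → ℝ) 1, ℂ)

/-- The restriction of `cosProd k` to the closed unit cube. -/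
def cosProdMap (k : Fin d → ℕ) : CubeMap d :=
  ⟨fun x => (cosProd k x.1 : ℂ),
    (continuous_modeProd (fun _ => continuous_cosMode) k).comp continuous_subtype_val⟩

/-- The function `x ↦ cos (π x_i)` on the closed unit cube. -/
def cosCoord (i : Fin d) : CubeMap d :=
  ⟨fun x => ((cos (π * x.1 i) : ℝ) : ℂ), Complex.continuous_ofReal.comp
    (continuous_cos.comp (continuous_const.mul
      ((continuous_apply i).comp continuous_subtype_val)))⟩

lemma cosMode_mul_cos (a : ℕ) : ∃ (p q : ℝ) (b c : ℕ), ∀ t,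
    cosMode a t * cos (π * t) = p * cosMode b t + q * cosMode c t := by
  have h2 : √2 * √2 = 2 := mul_self_sqrt zero_le_two
  match a with
  | 0 => exact ⟨√2 / 2, 0, 1, 0, fun t => by
      simp [cosMode]
      linear_combination (-cos (π * t) / 2) * h2⟩
  | 1 => exact ⟨1 / 2, √2 / 2, 2, 0, fun t => by
      simp [cosMode]
      have : π * 2 * t = 2 * (π * t) := by ring
      rw [this, cos_two_mul]
      ring⟩
  | n + 2 => exact ⟨1 / 2, 1 / 2, n + 3, n + 1, fun t => by
      simp [cosMode]
      have e1 : π * (n + 3) * t = π * (n + 2) * t + π * t := by ring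
      have e2 : π * (n + 1) * t = π * (n + 2) * t - π * t := by ring
      rw [e1, e2, cos_add, cos_sub]
      ring⟩

lemma cosProd_update (k : Fin d → ℕ) (i : Fin d) (b : ℕ) (x : Fin d → ℝ) :
    cosProd (Function.update k i b) x =
      cosMode b (x i) * ∏ j ∈ Finset.univ.erase i, cosMode (k j) (x j) := by
  unfold cosProd modeProd
  rw [← Finset.mul_prod_erase _ _ (Finset.mem_univ i), Function.update_self]
  congr 1
  refine Finset.prod_congr rfl fun j hj => ?_
  rw [Function.update_of_ne (Finset.ne_of_mem_erase hj)]

lemma cosCoord_mul_mem_span (i : Fin d) {f : CubeMap d}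
    (hf : f ∈ Submodule.span ℂ (range (cosProdMap (d := d)))) :
    cosCoord i * f ∈ Submodule.span ℂ (range (cosProdMap (d := d))) := by
  induction hf using Submodule.span_induction with
  | mem f hf =>
    obtain ⟨k, rfl⟩ := hf
    obtain ⟨p, q, b, c, h⟩ := cosMode_mul_cos (k i)
    have : cosCoord i * cosProdMap k = (p : ℂ) • cosProdMap (Function.update k i b) +
        (q : ℂ) • cosProdMap (Function.update k i c) := by
      ext x
      have h0 := cosProd_update k i (k i) x.1
      rw [Function.update_eq_self] at h0
      simp only [cosCoord, cosProdMap, ContinuousMap.mul_apply, ContinuousMap.coe_mk,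
        ContinuousMap.add_apply, ContinuousMap.smul_apply, smul_eq_mul]
      rw [cosProd_update, cosProd_update, h0]
      norm_cast
      linear_combination (∏ j ∈ Finset.univ.erase i, cosMode (k j) (x.1 j)) * h (x.1 i)
    rw [this]
    exact Submodule.add_mem _ (Submodule.smul_mem _ _ (Submodule.subset_span ⟨_, rfl⟩))
      (Submodule.smul_mem _ _ (Submodule.subset_span ⟨_, rfl⟩))
  | zero => simp
  | add f g _ _ hf hg =>
    rw [mul_add]
    exact Submodule.add_mem _ hf hg
  | smul c f _ hf =>
    rw [mul_smul_comm]
    exact Submodule.smul_mem _ _ hf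

lemma adjoin_cosCoord_le_span {f : CubeMap d}
    (hf : f ∈ StarAlgebra.adjoin ℂ (range (cosCoord (d := d)))) :
    f ∈ Submodule.span ℂ (range (cosProdMap (d := d))) := by
  have hstar : star (range (cosCoord (d := d))) = range (cosCoord (d := d)) := by
    have h (i : Fin d) : star (cosCoord i) = cosCoord i := by
      ext x
      simp only [cosCoord, ContinuousMap.star_apply, ContinuousMap.coe_mk]
      exact Complex.conj_ofReal _
    ext f
    rw [Set.mem_star]
    constructor
    · rintro ⟨i, hi⟩
      exact ⟨i, by rw [← h i, hi, star_star]⟩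
    · rintro ⟨i, rfl⟩
      exact ⟨i, (h i).symm⟩
  rw [← StarSubalgebra.mem_toSubalgebra, StarAlgebra.adjoin_toSubalgebra, hstar,
    union_self] at hf
  have key : ∀ g ∈ Submodule.span ℂ (range (cosProdMap (d := d))),
      f * g ∈ Submodule.span ℂ (range (cosProdMap (d := d))) := by
    induction hf using Algebra.adjoin_induction with
    | mem f hf =>
      obtain ⟨i, rfl⟩ := hf
      exact fun g hg => cosCoord_mul_mem_span i hg
    | algebraMap r =>
      intro g hg
      rw [← Algebra.smul_def]
      exact Submodule.smul_mem _ _ hg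
    | add f₁ f₂ _ _ h₁ h₂ =>
      intro g hg
      rw [add_mul]
      exact Submodule.add_mem _ (h₁ g hg) (h₂ g hg)
    | mul f₁ f₂ _ _ h₁ h₂ =>
      intro g hg
      rw [mul_assoc]
      exact h₁ _ (h₂ g hg)
  have h1 : (1 : CubeMap d) = cosProdMap 0 := by
    ext x
    simp [cosProdMap, modeProd, cosMode]
  have := key 1 (h1 ▸ Submodule.subset_span ⟨0, rfl⟩)
  rwa [mul_one] at this

lemma span_cosProdMap_dense :
    Dense (Submodule.span ℂ (range (cosProdMap (d := d))) : Set (CubeMap d)) := by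
  have h := ContinuousMap.starSubalgebra_topologicalClosure_eq_top_of_separatesPoints
    (StarAlgebra.adjoin ℂ (range (cosCoord (d := d)))) ?_
  · refine Dense.mono (fun f hf => adjoin_cosCoord_le_span hf) ?_
    rw [dense_iff_closure_eq, ← StarSubalgebra.topologicalClosure_coe, h]
    rfl
  · intro x y hxy
    obtain ⟨i, hi⟩ := Function.ne_iff.1 fun h => hxy (Subtype.ext h)
    refine ⟨_, ⟨cosCoord i, StarAlgebra.subset_adjoin ℂ _ ⟨i, rfl⟩, rfl⟩, fun h => hi ?_⟩
    have hI (z : Icc (0 : Fin d → ℝ) 1) : π * z.1 i ∈ Icc 0 π :=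
      ⟨mul_nonneg pi_nonneg (z.2.1 i), mul_le_of_le_one_right pi_nonneg (z.2.2 i)⟩
    have hcos : cos (π * x.1 i) = cos (π * y.1 i) := by
      simp only [cosCoord, ContinuousMap.coe_mk] at h
      exact_mod_cast h
    exact mul_left_cancel₀ pi_ne_zero (injOn_cos (hI x) (hI y) hcos)

/-- The class in `L²` of `cosProd k`. -/
def cosL2 (k : Fin d → ℕ) : Lp ℂ 2 (cubeMeasure d) :=
  toL2 _ (continuous_modeProd (fun _ => continuous_cosMode) k)

lemma orthonormal_cosL2 : Orthonormal ℂ (cosL2 (d := d)) :=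
  (orthonormal_modeProd (fun _ => continuous_cosMode) (fun _ => True)
    fun k _ i b => integral_cosMode_mul (k i) b).comp (fun k => ⟨k, trivial⟩)
    fun _ _ h => congrArg Subtype.val h

lemma exists_extension_of_mem_span {g : CubeMap d}
    (hg : g ∈ Submodule.span ℂ (range (cosProdMap (d := d)))) :
    ∃ (p : (Fin d → ℝ) → ℂ) (hp : Continuous p), (∀ x, g x = p x.1) ∧
      toL2 p hp ∈ Submodule.span ℂ (range (cosL2 (d := d))) := by
  induction hg using Submodule.span_induction with
  | mem f hf =>
    obtain ⟨k, rfl⟩ := hf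
    exact ⟨_, continuous_modeProd (fun _ => continuous_cosMode) k, fun x => rfl,
      Submodule.subset_span ⟨k, rfl⟩⟩
  | zero => exact ⟨0, continuous_zero, fun x => rfl, by
      rw [toL2, MemLp.toLp_zero]; exact Submodule.zero_mem _⟩
  | add f g _ _ hf hg =>
    obtain ⟨p, hp, hp1, hp2⟩ := hf
    obtain ⟨q, hq, hq1, hq2⟩ := hg
    refine ⟨p + q, hp.add hq, fun x => by simp [hp1, hq1], ?_⟩
    rw [toL2, MemLp.toLp_add (memLp_of_continuous hp) (memLp_of_continuous hq)]
    exact Submodule.add_mem _ hp2 hq2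
  | smul c f _ hf =>
    obtain ⟨p, hp, hp1, hp2⟩ := hf
    refine ⟨c • p, hp.const_smul c, fun x => by simp [hp1], ?_⟩
    rw [toL2, MemLp.toLp_const_smul c (memLp_of_continuous hp)]
    exact Submodule.smul_mem _ _ hp2

lemma norm_toL2_sub_le {f g : (Fin d → ℝ) → ℂ} (hf : Continuous f) (hg : Continuous g) {C : ℝ}
    (hC : 0 ≤ C) (h : ∀ x ∈ Icc (0 : Fin d → ℝ) 1, ‖f x - g x‖ ≤ C) :
    ‖toL2 f hf - toL2 g hg‖ ≤ C := by
  have h1 : toL2 f hf - toL2 g hg = toL2 (f - g) (hf.sub hg) :=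
    (MemLp.toLp_sub (memLp_of_continuous hf) (memLp_of_continuous hg)).symm
  rw [h1]
  have h2 := Lp.norm_le_of_ae_bound (f := toL2 (f - g) (hf.sub hg)) (C := C) hC ?_
  · simpa [measureUnivNNReal] using h2
  · filter_upwards [ae_mem_Icc, (memLp_of_continuous (hf.sub hg)).coeFn_toLp] with x hx h2
    rw [toL2, h2]
    exact h x hx

lemma span_cosL2_dense :
    ⊤ ≤ (Submodule.span ℂ (range (cosL2 (d := d)))).topologicalClosure := by
  have hcont (f : (Fin d → ℝ) → ℂ) (hf : Continuous f) :
      toL2 f hf ∈ (Submodule.span ℂ (range (cosL2 (d := d)))).topologicalClosure := by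
    rw [← SetLike.mem_coe, Submodule.topologicalClosure_coe, Metric.mem_closure_iff]
    intro ε hε
    obtain ⟨g, hg, hfg⟩ := Metric.dense_iff.1 (span_cosProdMap_dense (d := d))
      ⟨fun x => f x.1, hf.comp continuous_subtype_val⟩ (ε / 2) (by positivity)
    obtain ⟨p, hp, hp1, hp2⟩ := exists_extension_of_mem_span hfg
    refine ⟨_, hp2, ?_⟩
    rw [dist_eq_norm]
    refine (norm_toL2_sub_le hf hp (half_pos hε).le fun x hx => ?_).trans_lt (half_lt_self hε)
    rw [← hp1 ⟨x, hx⟩, ← dist_eq_norm, dist_comm]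
    exact (ContinuousMap.dist_apply_le_dist (f := g)
      (g := ⟨fun x => f x.1, hf.comp continuous_subtype_val⟩) ⟨x, hx⟩).trans hg.le
  intro f _
  have hd := BoundedContinuousFunction.toLp_denseRange ℂ (cubeMeasure d) ℂ
    (p := 2) (by norm_num)
  rw [← SetLike.mem_coe]
  refine (Submodule.isClosed_topologicalClosure _).closure_subset_iff.2 ?_ (hd f)
  rintro _ ⟨g, rfl⟩
  exact hcont g g.continuous

/-- The Neumann eigenfunctions form a Hilbert basis of `L²` of the unit cube. -/
def cosBasis (d : ℕ) : HilbertBasis (Fin d → ℕ) ℂ (Lp ℂ 2 (cubeMeasure d)) :=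
  HilbertBasis.mk orthonormal_cosL2 span_cosL2_dense

lemma cosBasis_apply (k : Fin d → ℕ) : cosBasis d k = cosL2 k := by
  rw [cosBasis, HilbertBasis.coe_mk]

/-- Products of cosines in all directions but the `m`-th one, where there is a sine. -/
abbrev sinProd (m : Fin d) (k : Fin d → ℕ) : (Fin d → ℝ) → ℝ :=
  modeProd (fun i => if i = m then sinMode else cosMode) k

lemma continuous_sinProd_factor (m i : Fin d) (a : ℕ) :
    Continuous ((if i = m then sinMode else cosMode) a) := by
  split_ifs
  exacts [continuous_sinMode a, continuous_cosMode a]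

lemma contDiff_sinProd (m : Fin d) (k : Fin d → ℕ) :
    ContDiff ℝ 1 fun x => (sinProd m k x : ℂ) := by
  have h : ContDiff ℝ 1 (sinProd m k) := by
    unfold sinProd modeProd
    refine contDiff_prod fun i _ => ?_
    have : ContDiff ℝ 1 ((if i = m then sinMode else cosMode) (k i)) := by
      split_ifs
      · unfold sinMode; fun_prop
      · unfold cosMode; split_ifs <;> fun_prop
    exact this.comp (contDiff_apply ℝ ℝ i)
  exact Complex.ofRealCLM.contDiff.comp h

lemma sinProd_eq (m : Fin d) (k : Fin d → ℕ) (x : Fin d → ℝ) :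
    sinProd m k x = sinMode (k m) (x m) * ∏ j ∈ Finset.univ.erase m, cosMode (k j) (x j) := by
  unfold sinProd modeProd
  rw [← Finset.mul_prod_erase _ _ (Finset.mem_univ m)]
  dsimp only
  rw [if_pos rfl]
  congr 1
  refine Finset.prod_congr rfl fun j hj => ?_
  rw [if_neg (Finset.ne_of_mem_erase hj)]

lemma fderiv_sinProd (m : Fin d) (k : Fin d → ℕ) (hk : k m ≠ 0) (x : Fin d → ℝ) :
    fderiv ℝ (fun x => (sinProd m k x : ℂ)) x (Pi.single m 1) =
      ((π * k m : ℝ) : ℂ) * (cosProd k x : ℂ) := by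
  have h0 := cosProd_update k m (k m) x
  rw [Function.update_eq_self] at h0
  rw [← ((contDiff_sinProd m k).differentiable one_ne_zero x).lineDeriv_eq_fderiv, lineDeriv, h0]
  have h (t : ℝ) : sinProd m k (x + t • Pi.single m 1) =
      sinMode (k m) (x m + t) * ∏ j ∈ Finset.univ.erase m, cosMode (k j) (x j) := by
    rw [sinProd_eq]
    congr 1
    · simp
    · refine Finset.prod_congr rfl fun j hj => ?_
      simp [Finset.ne_of_mem_erase hj]
  simp_rw [h]
  have h1 : HasDerivAt (fun t => sinMode (k m) (x m + t)) (π * k m * cosMode (k m) (x m)) 0 := by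
    have h2 : HasDerivAt (fun t : ℝ => π * k m * (x m + t)) (π * k m * 1) 0 :=
      ((hasDerivAt_id (0 : ℝ)).const_add (x m)).const_mul _
    have h3 := h2.sin.const_mul √2
    simp only [cosMode, hk, if_false]
    rw [add_zero] at h3
    exact h3.congr_deriv (by ring)
  have h4 := (h1.mul_const (∏ j ∈ Finset.univ.erase m, cosMode (k j) (x j))).ofReal_comp
  rw [h4.deriv]
  push_cast
  ring

lemma sinMode_one (a : ℕ) : sinMode a 1 = 0 := by
  rw [sinMode, mul_one, mul_comm π, sin_nat_mul_pi, mul_zero]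

lemma sinMode_zero (a : ℕ) : sinMode a 0 = 0 := by simp [sinMode]

lemma integral_fderiv_eq_zero {n : ℕ} (m : Fin (n + 1)) {F : (Fin (n + 1) → ℝ) → ℂ}
    (hF : ContDiff ℝ 1 F) (h0 : ∀ x, x m = 0 → F x = 0) (h1 : ∀ x, x m = 1 → F x = 0) :
    ∫ x, fderiv ℝ F x (Pi.single m 1) ∂cubeMeasure (n + 1) = 0 := by
  have hsum (x : Fin (n + 1) → ℝ) :
      ∑ i, (if i = m then fderiv ℝ F x else 0) (Pi.single i 1) =
        fderiv ℝ F x (Pi.single m 1) := by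
    rw [Finset.sum_eq_single m (fun i _ hi => by simp [hi]) (by simp), if_pos rfl]
  have hc : Continuous fun x => fderiv ℝ F x (Pi.single m 1) :=
    (hF.continuous_fderiv one_ne_zero).clm_apply continuous_const
  have h := integral_divergence_of_hasFDerivAt_off_countable' (0 : Fin (n + 1) → ℝ) 1
    zero_le_one (fun i => if i = m then F else 0)
    (fun i x => if i = m then fderiv ℝ F x else 0) ∅ countable_empty ?_ ?_ ?_
  · simp_rw [hsum] at h
    rw [cubeMeasure_eq_restrict_Icc, h]
    refine Finset.sum_eq_zero fun i _ => ?_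
    split_ifs with hi
    · subst hi
      simp [h0, h1]
    · simp
  · intro i
    split_ifs
    exacts [hF.continuous.continuousOn, continuousOn_const]
  · intro x _ i
    split_ifs
    exacts [(hF.differentiable one_ne_zero x).hasFDerivAt, hasFDerivAt_const _ _]
  · simp_rw [hsum]
    exact hc.continuousOn.integrableOn_compact isCompact_Icc

lemma integral_fderiv_mul_sinProd (m : Fin d) (k : Fin d → ℕ) (hk : k m ≠ 0)
    {f : (Fin d → ℝ) → ℂ} (hf : ContDiff ℝ 1 f) :
    ∫ x, fderiv ℝ f x (Pi.single m 1) * (sinProd m k x : ℂ) ∂cubeMeasure d =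
      -((π * k m : ℝ) : ℂ) * ∫ x, f x * (cosProd k x : ℂ) ∂cubeMeasure d := by
  obtain ⟨n, rfl⟩ : ∃ n, d = n + 1 := ⟨d - 1, by have := m.pos; omega⟩
  have hS := contDiff_sinProd m k
  have h := integral_fderiv_eq_zero m (hf.mul hS)
    (fun x hx => by simp [sinProd_eq, hx, sinMode_zero])
    (fun x hx => by simp [sinProd_eq, hx, sinMode_one])
  have hd (x : Fin (n + 1) → ℝ) :
      fderiv ℝ (fun x => f x * (sinProd m k x : ℂ)) x (Pi.single m 1) =
        fderiv ℝ f x (Pi.single m 1) * (sinProd m k x : ℂ) +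
          ((π * k m : ℝ) : ℂ) * (f x * (cosProd k x : ℂ)) := by
    rw [fderiv_fun_mul (hf.differentiable one_ne_zero x) (hS.differentiable one_ne_zero x)]
    simp only [add_apply, smul_apply, smul_eq_mul]
    rw [fderiv_sinProd m k hk]
    ring
  have hc : Continuous fun x => fderiv ℝ f x (Pi.single m 1) :=
    (hf.continuous_fderiv one_ne_zero).clm_apply continuous_const
  have hcos : Continuous fun x => (cosProd k x : ℂ) :=
    continuous_modeProd (fun _ => continuous_cosMode) k
  replace h : ∫ x, fderiv ℝ (fun x => f x * (sinProd m k x : ℂ)) x (Pi.single m 1)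
      ∂cubeMeasure (n + 1) = 0 := h
  simp_rw [hd] at h
  have hi₁ : Integrable (fun x => fderiv ℝ f x (Pi.single m 1) * (sinProd m k x : ℂ))
      (cubeMeasure (n + 1)) := integrable_of_continuous (hc.mul hS.continuous)
  have hi₂ : Integrable (fun x => ((π * k m : ℝ) : ℂ) * (f x * (cosProd k x : ℂ)))
      (cubeMeasure (n + 1)) :=
    integrable_of_continuous (continuous_const.mul (hf.continuous.mul hcos))
  rw [integral_add hi₁ hi₂, integral_const_mul] at h
  linear_combination h

lemma orthonormal_sinProd (m : Fin d) :
    Orthonormal ℂ fun k : {k : Fin d → ℕ // k m ≠ 0} =>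
      toL2 _ (continuous_modeProd (continuous_sinProd_factor m) k.1) := by
  refine orthonormal_modeProd (continuous_sinProd_factor m) (fun k => k m ≠ 0) fun k hk i b => ?_
  split_ifs with hi
  · subst hi
    rw [integral_sinMode_mul _ _ hk]
    simp_all
  · rw [integral_sinMode_mul _ _ (hi ▸ hk)]
    simp_all
  · rw [integral_cosMode_mul]
    simp_all
  · rw [integral_cosMode_mul]
    simp_all

/-- Bessel's inequality for the derivative of `f` in the direction `m`. -/
lemma tsum_sq_mul_coeff_le (m : Fin d) {f : (Fin d → ℝ) → ℂ} (hf : ContDiff ℝ 1 f) :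
    ∑' k : Fin d → ℕ, ENNReal.ofReal ((k m : ℝ) ^ 2 * ‖inner ℂ (cosL2 k) (toL2 f hf.continuous)‖ ^ 2)
      ≤ ∫⁻ x, ENNReal.ofReal (‖fderiv ℝ f x (Pi.single m 1)‖ ^ 2) ∂cubeMeasure d := by
  have hc : Continuous fun x => fderiv ℝ f x (Pi.single m 1) :=
    (hf.continuous_fderiv one_ne_zero).clm_apply continuous_const
  rw [lintegral_norm_sq_toL2 hc]
  have hv := orthonormal_sinProd m
  rw [← tsum_subtype_eq_of_support_subset (s := {k | k m ≠ 0}) fun k hk h => hk (by simp_all)]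
  refine le_trans ?_ (ENNReal.ofReal_le_ofReal (hv.tsum_inner_products_le (toL2 _ hc)))
  rw [ENNReal.ofReal_tsum_of_nonneg (fun _ => by positivity) (hv.inner_products_summable (toL2 _ hc))]
  refine ENNReal.tsum_le_tsum fun k => ENNReal.ofReal_le_ofReal ?_
  rw [cosL2, inner_toL2, inner_toL2]
  simp_rw [Complex.conj_ofReal]
  rw [integral_fderiv_mul_sinProd m k.1 k.2 hf, norm_mul, mul_pow]
  gcongr
  rw [norm_neg, Complex.norm_real, Real.norm_of_nonneg (by positivity)]
  exact le_mul_of_one_le_left (by positivity) (by linarith [pi_gt_three])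

/-- The frequencies in `{0, …, n}^d`. -/
def lowFreq (d n : ℕ) : Finset (Fin d → ℕ) := Fintype.piFinset fun _ => Finset.range (n + 1)

/-- The part of `f` of frequencies in `{0, …, n}^d`. -/
def lowPart (n : ℕ) {f : (Fin d → ℝ) → ℂ} (hf : Continuous f) (x : Fin d → ℝ) : ℂ :=
  ∑ k ∈ lowFreq d n, inner ℂ (cosL2 k) (toL2 f hf) * (cosProd k x : ℂ)

lemma continuous_lowPart (n : ℕ) {f : (Fin d → ℝ) → ℂ} (hf : Continuous f) :
    Continuous (lowPart n hf) :=
  continuous_finsetSum _ fun k _ =>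
    continuous_const.mul (continuous_modeProd (fun _ => continuous_cosMode) k)

lemma toL2_sum {ι : Type*} (s : Finset ι) (c : ι → ℂ) {g : ι → (Fin d → ℝ) → ℂ}
    (hg : ∀ i, Continuous (g i)) (h : Continuous fun x => ∑ i ∈ s, c i * g i x) :
    toL2 (fun x => ∑ i ∈ s, c i * g i x) h = ∑ i ∈ s, c i • toL2 (g i) (hg i) := by
  classical
  induction s using Finset.induction_on with
  | empty =>
    simp only [Finset.sum_empty]
    exact MemLp.toLp_zero _
  | insert a s ha ih =>
    have hs : Continuous fun x => ∑ i ∈ s, c i * g i x :=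
      continuous_finsetSum _ fun i _ => continuous_const.mul (hg i)
    rw [Finset.sum_insert ha, ← ih hs, toL2, toL2, toL2,
      ← MemLp.toLp_const_smul, ← MemLp.toLp_add]
    congr 1
    ext x
    simp [Finset.sum_insert ha]

lemma lintegral_norm_sub_lowPart (n : ℕ) {f : (Fin d → ℝ) → ℂ} (hf : Continuous f) :
    ∫⁻ x, ENNReal.ofReal (‖f x - lowPart n hf x‖ ^ 2) ∂cubeMeasure d =
      ∑' k, if k ∈ lowFreq d n then 0 else
        ENNReal.ofReal (‖inner ℂ (cosL2 k) (toL2 f hf)‖ ^ 2) := by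
  have hsub : Continuous fun x => f x - lowPart n hf x := hf.sub (continuous_lowPart n hf)
  rw [lintegral_norm_sq_toL2 hsub]
  have h1 : toL2 _ hsub = toL2 f hf -
      ∑ k ∈ lowFreq d n, inner ℂ (cosL2 k) (toL2 f hf) • cosL2 k := by
    have hlow : toL2 _ (continuous_lowPart n hf) =
        ∑ k ∈ lowFreq d n, inner ℂ (cosL2 k) (toL2 f hf) • cosL2 k :=
      toL2_sum _ _ (continuous_modeProd fun _ => continuous_cosMode) _
    rw [← hlow]
    exact MemLp.toLp_sub (memLp_of_continuous hf) (memLp_of_continuous (continuous_lowPart n hf))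
  rw [h1]
  set Ψ := toL2 f hf
  set y := Ψ - ∑ k ∈ lowFreq d n, inner ℂ (cosL2 k) Ψ • cosL2 k
  have hy (k : Fin d → ℕ) : inner ℂ (cosL2 k) y =
      if k ∈ lowFreq d n then 0 else inner ℂ (cosL2 k) Ψ := by
    simp only [y, inner_sub_right, inner_sum, inner_smul_right,
      orthonormal_iff_ite.1 orthonormal_cosL2]
    simp
    split_ifs <;> simp
  have hpars : HasSum (fun k => ‖inner ℂ (cosL2 k) y‖ ^ 2) (‖y‖ ^ 2) := by
    have h := (cosBasis d).hasSum_inner_mul_inner y y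
    simp_rw [cosBasis_apply] at h
    have h' := Complex.hasSum_re h
    convert h' using 1
    · ext k
      rw [← inner_conj_symm y (cosL2 k), Complex.conj_mul']
      norm_cast
    · rw [inner_self_eq_norm_sq_to_K]
      norm_cast
  rw [← hpars.tsum_eq, ENNReal.ofReal_tsum_of_nonneg (fun _ => by positivity) hpars.summable]
  refine tsum_congr fun k => ?_
  rw [hy]
  split_ifs <;> simp

lemma tsum_odd_mul_indicator (a : ℕ) :
    ∑' n : ℕ, (2 * n + 1 : ENNReal) * (if n < a then 1 else 0) = (a : ENNReal) ^ 2 := by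
  rw [tsum_eq_sum (s := Finset.range a) (by simp +contextual)]
  induction a with
  | zero => simp
  | succ a ih =>
    rw [Finset.sum_range_succ, if_pos a.lt_succ_self]
    have : ∑ n ∈ Finset.range a, (2 * n + 1 : ENNReal) * (if n < a + 1 then 1 else 0) =
        ∑ n ∈ Finset.range a, (2 * n + 1 : ENNReal) * (if n < a then 1 else 0) := by
      refine Finset.sum_congr rfl fun n hn => ?_
      have := Finset.mem_range.1 hn
      rw [if_pos this, if_pos (by omega)]
    rw [this, ih]
    push_cast
    ring

/-- The discrete analogue of Rumin's representation of the kinetic energy. -/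
lemma tsum_lintegral_norm_sub_lowPart_le {f : (Fin d → ℝ) → ℂ} (hf : ContDiff ℝ 1 f) :
    ∑' n : ℕ, (2 * n + 1 : ENNReal) *
        ∫⁻ x, ENNReal.ofReal (‖f x - lowPart n hf.continuous x‖ ^ 2) ∂cubeMeasure d ≤
      ∫⁻ x, ENNReal.ofReal (∑ m, ‖fderiv ℝ f x (Pi.single m 1)‖ ^ 2) ∂cubeMeasure d := by
  have hc (m : Fin d) : Continuous fun x => fderiv ℝ f x (Pi.single m 1) :=
    (hf.continuous_fderiv one_ne_zero).clm_apply continuous_const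
  simp_rw [ENNReal.ofReal_sum_of_nonneg fun _ _ => sq_nonneg _]
  have hmeas (m : Fin d) : Measurable fun x =>
      ENNReal.ofReal (‖fderiv ℝ f x (Pi.single m 1)‖ ^ 2) :=
    ((hc m).norm.pow 2).measurable.ennreal_ofReal
  rw [lintegral_finsetSum _ fun m _ => hmeas m]
  refine le_trans ?_ (Finset.sum_le_sum fun m _ => tsum_sq_mul_coeff_le m hf)
  simp_rw [lintegral_norm_sub_lowPart, ← ENNReal.tsum_mul_left]
  rw [ENNReal.tsum_comm, ← Summable.tsum_finsetSum fun _ _ => ENNReal.summable]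
  refine ENNReal.tsum_le_tsum fun k => ?_
  set A := ‖inner ℂ (cosL2 k) (toL2 f hf.continuous)‖ ^ 2
  calc ∑' n : ℕ, (2 * n + 1 : ENNReal) * (if k ∈ lowFreq d n then 0 else ENNReal.ofReal A)
      ≤ ∑' n : ℕ, ∑ m, (2 * n + 1 : ENNReal) * (if n < k m then 1 else 0) * ENNReal.ofReal A := by
        refine ENNReal.tsum_le_tsum fun n => ?_
        split_ifs with h
        · simp
        · simp only [lowFreq, Fintype.mem_piFinset, Finset.mem_range, not_forall] at h
          obtain ⟨m, hm⟩ := h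
          refine le_trans ?_ (Finset.single_le_sum (fun _ _ => zero_le) (Finset.mem_univ m))
          rw [if_pos (by omega), mul_one]
    _ = ∑ m, ENNReal.ofReal ((k m : ℝ) ^ 2 * A) := by
        rw [Summable.tsum_finsetSum fun _ _ => ENNReal.summable]
        refine Finset.sum_congr rfl fun m _ => ?_
        rw [ENNReal.tsum_mul_right, tsum_odd_mul_indicator, ENNReal.ofReal_mul (by positivity),
          ENNReal.ofReal_pow (k m).cast_nonneg, ENNReal.ofReal_natCast]

lemma sum_cosMode_sq_le (n : ℕ) (t : ℝ) :
    ∑ a ∈ Finset.range (n + 1), cosMode a t ^ 2 ≤ 1 + 2 * n := by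
  rw [Finset.sum_range_succ']
  have h (a : ℕ) : cosMode (a + 1) t ^ 2 ≤ 2 := by
    simp only [cosMode, Nat.add_eq_zero_iff, one_ne_zero, and_false, if_false]
    rw [mul_pow, sq_sqrt zero_le_two]
    nlinarith [cos_sq_le_one (π * (a + 1 : ℕ) * t)]
  have := Finset.sum_le_sum fun a (_ : a ∈ Finset.range n) => h a
  simp [cosMode] at this ⊢
  linarith

lemma sum_cosProd_sq_le (n : ℕ) (x : Fin d → ℝ) :
    ∑ k ∈ lowFreq d n, cosProd k x ^ 2 ≤ (1 + 2 * n) ^ d := by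
  have h : ∑ k ∈ lowFreq d n, cosProd k x ^ 2 =
      ∏ i, ∑ a ∈ Finset.range (n + 1), cosMode a (x i) ^ 2 := by
    rw [Finset.prod_univ_sum]
    simp_rw [cosProd, modeProd, Finset.prod_pow]
    rfl
  rw [h]
  refine (Finset.prod_le_prod (fun _ _ => by positivity)
    fun i _ => sum_cosMode_sq_le n (x i)).trans ?_
  simp

lemma sum_norm_lowPart_sq_le {ι : Type*} [Fintype ι] (n : ℕ) {f : ι → (Fin d → ℝ) → ℂ}
    (hf : ∀ j, Continuous (f j)) (ho : Orthonormal ℂ fun j => toL2 (f j) (hf j))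
    (x : Fin d → ℝ) :
    ∑ j, ‖lowPart n (hf j) x‖ ^ 2 ≤ (1 + 2 * n) ^ d := by
  set G : Lp ℂ 2 (cubeMeasure d) := ∑ k ∈ lowFreq d n, (cosProd k x : ℂ) • cosL2 k with hG
  have hn : ‖G‖ ^ 2 = ∑ k ∈ lowFreq d n, cosProd k x ^ 2 := by
    have h : inner ℂ G G = ∑ k ∈ lowFreq d n, ((cosProd k x : ℂ)) ^ 2 := by
      rw [hG, orthonormal_cosL2.inner_sum]
      simp [sq]
    rw [inner_self_eq_norm_sq_to_K] at h
    exact Complex.ofReal_injective (((Complex.ofReal_pow _ _).trans h).trans (by push_cast; rfl))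
  refine le_trans ?_ ((ho.sum_inner_products_le (s := Finset.univ) G).trans
    (hn.trans_le (sum_cosProd_sq_le n x)))
  refine (Finset.sum_congr rfl fun j _ => ?_).le
  rw [← norm_inner_symm, hG, sum_inner, lowPart]
  simp_rw [inner_smul_left, Complex.conj_ofReal, mul_comm]

lemma sq_max_sqrt_sub_le {ι : Type*} [Fintype ι] (u v : ι → ℂ) {b : ℝ}
    (hv : ∑ j, ‖v j‖ ^ 2 ≤ b) :
    max (√(∑ j, ‖u j‖ ^ 2) - √b) 0 ^ 2 ≤ ∑ j, ‖u j - v j‖ ^ 2 := by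
  have h := norm_sub_norm_le (WithLp.toLp 2 u) (WithLp.toLp 2 v)
  simp only [EuclideanSpace.norm_eq, PiLp.sub_apply] at h
  have h2 := sqrt_le_sqrt hv
  rw [← sq_sqrt (show 0 ≤ ∑ j, ‖u j - v j‖ ^ 2 by positivity)]
  gcongr
  exact max_le (by linarith) (sqrt_nonneg _)

lemma sum_range_odd (n : ℕ) : ∑ m ∈ Finset.range n, (2 * m + 1 : ℝ) = n ^ 2 := by
  induction n with
  | zero => simp
  | succ n ih => rw [Finset.sum_range_succ, ih]; push_cast; ring

lemma rpow_max_sub_one_le_tsum (hd : 1 ≤ d) (s : ℝ) :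
    ENNReal.ofReal (1 / 9 * (1 / 2) ^ (2 * ((d : ℝ) + 2) / d) *
        max (s - 1) 0 ^ (2 * ((d : ℝ) + 2) / d)) ≤
      ∑' n : ℕ, (2 * n + 1 : ENNReal) *
        ENNReal.ofReal (max (s - √((1 + 2 * n) ^ d)) 0 ^ 2) := by
  have hd0 : (0 : ℝ) < d := by exact_mod_cast hd
  set p := 2 * ((d : ℝ) + 2) / d with hp
  have hp0 : 0 < p := by positivity
  rcases le_or_gt s 1 with hs | hs
  · rw [max_eq_right (by linarith), zero_rpow hp0.ne']
    simp
  set t := (s - 1) / 2 with ht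
  have ht0 : 0 < t := by rw [ht]; linarith
  set y := (1 + t) ^ (2 / (d : ℝ)) with hy
  have hy1 : 1 ≤ y := one_le_rpow (by linarith) (by positivity)
  have hyd : y ^ d = (1 + t) ^ 2 := by
    rw [hy, ← rpow_natCast, ← rpow_mul (by linarith), div_mul_cancel₀ _ hd0.ne']
    norm_cast
  set n := ⌊(y - 1) / 2⌋₊ with hn
  have hterm (m : ℕ) (hm : m ∈ Finset.range (n + 1)) :
      t ≤ max (s - √((1 + 2 * m) ^ d)) 0 := by
    have hmn : (m : ℝ) ≤ n := by exact_mod_cast Nat.lt_succ_iff.1 (Finset.mem_range.1 hm)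
    have hny : (n : ℝ) ≤ (y - 1) / 2 := Nat.floor_le (by linarith)
    have h1 : (1 + 2 * (m : ℝ)) ^ d ≤ (1 + t) ^ 2 := by
      rw [← hyd]
      gcongr
      linarith
    have h2 := sqrt_le_sqrt h1
    rw [sqrt_sq (by linarith)] at h2
    exact le_max_of_le_left (by rw [ht] at h2 ⊢; linarith)
  have hlow : t ^ (2 / (d : ℝ)) ≤ 3 * (n + 1) := by
    have h1 : t ^ (2 / (d : ℝ)) ≤ y := by
      rw [hy]
      gcongr
      linarith
    have h2 : (y - 1) / 2 < n + 1 := Nat.lt_floor_add_one _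
    have h3 : (0 : ℝ) ≤ n := n.cast_nonneg
    linarith
  have hpow : (1 / 2 : ℝ) ^ p * max (s - 1) 0 ^ p = t ^ 2 * (t ^ (2 / (d : ℝ))) ^ 2 := by
    rw [max_eq_left (by linarith), ← mul_rpow (by norm_num) (by linarith)]
    have h1 : 1 / 2 * (s - 1) = t := by rw [ht]; ring
    have h2 : p = (2 : ℕ) + 2 / (d : ℝ) * (2 : ℕ) := by
      rw [hp]; field_simp; push_cast; ring
    rw [h1, h2, rpow_add ht0, rpow_mul ht0.le, rpow_natCast, rpow_natCast]
  refine le_trans ?_ (ENNReal.sum_le_tsum (Finset.range (n + 1)))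
  calc ENNReal.ofReal (1 / 9 * (1 / 2) ^ p * max (s - 1) 0 ^ p)
      ≤ ENNReal.ofReal (∑ m ∈ Finset.range (n + 1), (2 * m + 1 : ℝ) * t ^ 2) := by
        refine ENNReal.ofReal_le_ofReal ?_
        rw [← Finset.sum_mul, sum_range_odd, mul_assoc, hpow]
        have h := pow_le_pow_left₀ (by positivity) hlow 2
        push_cast
        nlinarith [sq_nonneg t, mul_le_mul_of_nonneg_left h (sq_nonneg t)]
    _ = ∑ m ∈ Finset.range (n + 1), (2 * m + 1 : ENNReal) * ENNReal.ofReal (t ^ 2) := by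
        rw [ENNReal.ofReal_sum_of_nonneg fun _ _ => by positivity]
        refine Finset.sum_congr rfl fun m _ => ?_
        rw [ENNReal.ofReal_mul (by positivity), ENNReal.ofReal_add (by positivity) zero_le_one,
          ENNReal.ofReal_mul zero_le_two]
        simp
    _ ≤ _ := by
        refine Finset.sum_le_sum fun m hm => ?_
        gcongr
        exact hterm m hm

/-- The Neumann Lieb–Thirring inequality on the unit cube. -/
theorem neumann_lieb_thirring_unit_cube (hd : 1 ≤ d) {ι : Type*} [Fintype ι]
    {f : ι → (Fin d → ℝ) → ℂ} (hf : ∀ j, ContDiff ℝ 1 (f j))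
    (ho : Orthonormal ℂ fun j => toL2 (f j) (hf j).continuous) :
    ∫⁻ x, ENNReal.ofReal (1 / 9 * (1 / 2) ^ (2 * ((d : ℝ) + 2) / d) *
        max (√(∑ j, ‖f j x‖ ^ 2) - 1) 0 ^ (2 * ((d : ℝ) + 2) / d)) ∂cubeMeasure d ≤
      ∑ j, ∫⁻ x, ENNReal.ofReal (∑ m, ‖fderiv ℝ (f j) x (Pi.single m 1)‖ ^ 2)
        ∂cubeMeasure d := by
  have hmeas (n : ℕ) (j : ι) : Measurable fun x =>
      ENNReal.ofReal (‖f j x - lowPart n (hf j).continuous x‖ ^ 2) :=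
    (((hf j).continuous.sub (continuous_lowPart n (hf j).continuous)).norm.pow
      2).measurable.ennreal_ofReal
  calc _ ≤ ∫⁻ x, ∑' n : ℕ, (2 * n + 1 : ENNReal) *
          ∑ j, ENNReal.ofReal (‖f j x - lowPart n (hf j).continuous x‖ ^ 2) ∂cubeMeasure d := by
        refine lintegral_mono fun x => (rpow_max_sub_one_le_tsum hd _).trans
          (ENNReal.tsum_le_tsum fun n => ?_)
        gcongr
        rw [← ENNReal.ofReal_sum_of_nonneg fun _ _ => by positivity]
        exact ENNReal.ofReal_le_ofReal (sq_max_sqrt_sub_le _ _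
          (sum_norm_lowPart_sq_le n (fun j => (hf j).continuous) ho x))
    _ = ∑ j, ∑' n : ℕ, (2 * n + 1 : ENNReal) *
          ∫⁻ x, ENNReal.ofReal (‖f j x - lowPart n (hf j).continuous x‖ ^ 2) ∂cubeMeasure d := by
        rw [lintegral_tsum fun n =>
          ((Finset.measurable_fun_sum _ fun j _ => hmeas n j).const_mul _).aemeasurable,
          ← Summable.tsum_finsetSum fun _ _ => ENNReal.summable]
        refine tsum_congr fun n => ?_
        rw [lintegral_const_mul _ (Finset.measurable_fun_sum _ fun j _ => hmeas n j),
          lintegral_finsetSum _ fun j _ => hmeas n j, Finset.mul_sum]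
    _ ≤ _ := Finset.sum_le_sum fun j _ => tsum_lintegral_norm_sub_lowPart_le (hf j)

lemma sum_norm_sq_map_orthonormalBasis {ι E : Type*} [Fintype ι] [NormedAddCommGroup E]
    [InnerProductSpace ℝ E] [CompleteSpace E] (b c : OrthonormalBasis ι ℝ E) (T : E →L[ℝ] ℂ) :
    ∑ m, ‖T (b m)‖ ^ 2 = ∑ m, ‖T (c m)‖ ^ 2 := by
  have h (b : OrthonormalBasis ι ℝ E) (S : E →L[ℝ] ℝ) :
      ∑ m, S (b m) ^ 2 = ‖(InnerProductSpace.toDual ℝ E).symm S‖ ^ 2 := by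
    rw [← b.sum_sq_norm_inner_left]
    simp
  have hT (b : OrthonormalBasis ι ℝ E) : ∑ m, ‖T (b m)‖ ^ 2 =
      ∑ m, (Complex.reCLM ∘L T) (b m) ^ 2 + ∑ m, (Complex.imCLM ∘L T) (b m) ^ 2 := by
    rw [← Finset.sum_add_distrib]
    refine Finset.sum_congr rfl fun m _ => ?_
    rw [Complex.sq_norm, Complex.normSq_apply]
    simp [sq]
  rw [hT b, hT c, h b, h b, h c, h c]

/-- The parametrisation by the unit cube of the image by `f` of the cube of side `L`. -/
def cubeParam (f : EuclideanSpace ℝ (Fin d) ≃ᵢ EuclideanSpace ℝ (Fin d)) (L : ℝ)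
    (y : Fin d → ℝ) : EuclideanSpace ℝ (Fin d) :=
  f (WithLp.toLp 2 (L • y))

variable (f : EuclideanSpace ℝ (Fin d) ≃ᵢ EuclideanSpace ℝ (Fin d)) {L : ℝ}

lemma measurableEmbedding_cubeParam (hL : 0 < L) : MeasurableEmbedding (cubeParam f L) :=
  f.toHomeomorph.measurableEmbedding.comp
    ((MeasurableEquiv.toLp 2 (Fin d → ℝ)).measurableEmbedding.comp
      (measurableEmbedding_const_smul₀ hL.ne'))

lemma map_isometryEquiv_volume : (volume : Measure (EuclideanSpace ℝ (Fin d))).map f = volume := by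
  set A := f.toRealAffineIsometryEquiv with hA
  have hf : ⇑f = (fun x => x + f 0) ∘ A.linearIsometryEquiv := by
    ext1 x
    have h := A.map_vadd 0 x
    simp only [vadd_eq_add, add_zero] at h
    exact h
  rw [hf]
  exact ((measurePreserving_add_right volume (f 0)).comp
    A.linearIsometryEquiv.measurePreserving).map_eq

lemma map_cubeParam_volume (hL : 0 < L) :
    (volume : Measure (Fin d → ℝ)).map (cubeParam f L) = ENNReal.ofReal (L ^ d)⁻¹ • volume := by
  have h1 : cubeParam f L = f ∘ (WithLp.toLp 2) ∘ (L • ·) := rfl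
  rw [h1, ← Measure.map_map f.continuous.measurable (by fun_prop),
    ← Measure.map_map (by fun_prop) (by fun_prop), Measure.map_addHaar_smul _ hL.ne',
    Measure.map_smul, Measure.map_smul, (PiLp.volume_preserving_toLp (Fin d)).map_eq,
    map_isometryEquiv_volume]
  congr 2
  rw [Module.finrank_fin_fun, abs_of_pos (by positivity)]

lemma restrict_image_eq_map_cubeParam (hL : 0 < L) :
    volume.restrict (f '' {x : EuclideanSpace ℝ (Fin d) | ∀ m, x m ∈ Ioo 0 L}) =
      ENNReal.ofReal (L ^ d) • (cubeMeasure d).map (cubeParam f L) := by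
  have hS : cubeParam f L ⁻¹' (f '' {x : EuclideanSpace ℝ (Fin d) | ∀ m, x m ∈ Ioo 0 L}) =
      univ.pi fun _ => Ioo (0 : ℝ) 1 := by
    ext y
    simp only [cubeParam, mem_preimage, f.injective.mem_set_image, mem_ofPred_eq, mem_pi,
      mem_univ, true_imp_iff, Pi.smul_apply, smul_eq_mul, mem_Ioo]
    refine forall_congr' fun m => and_congr (mul_pos_iff_of_pos_left hL) ?_
    exact mul_lt_iff_lt_one_right hL
  rw [cubeMeasure_eq_restrict_Ioo, ← hS, ← (measurableEmbedding_cubeParam f hL).restrict_map,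
    map_cubeParam_volume f hL, Measure.restrict_smul, smul_smul,
    ← ENNReal.ofReal_mul (by positivity), mul_inv_cancel₀ (by positivity), ENNReal.ofReal_one,
    one_smul]

/-- The linear part of `cubeParam f L`. -/
def cubeParamLinear (L : ℝ) : (Fin d → ℝ) →L[ℝ] EuclideanSpace ℝ (Fin d) :=
  (f.toRealAffineIsometryEquiv.linearIsometryEquiv.toContinuousLinearEquiv :
      EuclideanSpace ℝ (Fin d) →L[ℝ] EuclideanSpace ℝ (Fin d)) ∘L
    ((PiLp.continuousLinearEquiv 2 ℝ fun _ : Fin d => ℝ).symm :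
      (Fin d → ℝ) →L[ℝ] EuclideanSpace ℝ (Fin d)) ∘L
    (L • ContinuousLinearMap.id ℝ (Fin d → ℝ))

lemma cubeParamLinear_single (m : Fin d) :
    cubeParamLinear f L (Pi.single m 1) =
      L • f.toRealAffineIsometryEquiv.linearIsometryEquiv (EuclideanSpace.single m 1) := by
  rw [← map_smul]
  rfl

lemma cubeParam_eq_add_const : cubeParam f L = fun y => cubeParamLinear f L y + f 0 := by
  ext1 y
  have h := f.toRealAffineIsometryEquiv.map_vadd 0 (WithLp.toLp 2 (L • y))
  simp only [vadd_eq_add, add_zero] at h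
  exact h

lemma hasFDerivAt_cubeParam (y : Fin d → ℝ) :
    HasFDerivAt (cubeParam f L) (cubeParamLinear f L) y := by
  rw [cubeParam_eq_add_const]
  exact (cubeParamLinear f L).hasFDerivAt.add_const _

lemma contDiff_cubeParam {n : WithTop ℕ∞} : ContDiff ℝ n (cubeParam f L) := by
  rw [cubeParam_eq_add_const]
  exact (cubeParamLinear f L).contDiff.add contDiff_const

lemma sum_norm_sq_fderiv_comp_cubeParam {φ : EuclideanSpace ℝ (Fin d) → ℂ} (hφ : ContDiff ℝ 1 φ)
    (c : ℝ) (y : Fin d → ℝ) :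
    ∑ m, ‖fderiv ℝ (fun y => (c : ℂ) * φ (cubeParam f L y)) y (Pi.single m 1)‖ ^ 2 =
      c ^ 2 * L ^ 2 *
        ∑ m, ‖fderiv ℝ φ (cubeParam f L y) (EuclideanSpace.single m (1 : ℝ))‖ ^ 2 := by
  have h1 := (((hφ.differentiable one_ne_zero (cubeParam f L y)).hasFDerivAt.comp y
    (hasFDerivAt_cubeParam f y)).const_mul (c : ℂ)).fderiv
  have h2 := sum_norm_sq_map_orthonormalBasis (EuclideanSpace.basisFun (Fin d) ℝ)
    ((EuclideanSpace.basisFun (Fin d) ℝ).map f.toRealAffineIsometryEquiv.linearIsometryEquiv)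
    (fderiv ℝ φ (cubeParam f L y))
  simp only [EuclideanSpace.basisFun_apply, OrthonormalBasis.map_apply] at h2
  rw [h2, Finset.mul_sum]
  refine Finset.sum_congr rfl fun m _ => ?_
  have h3 : fderiv ℝ (fun y => (c : ℂ) * φ (cubeParam f L y)) y (Pi.single m 1) =
      (c : ℂ) * (L * fderiv ℝ φ (cubeParam f L y)
        (f.toRealAffineIsometryEquiv.linearIsometryEquiv (EuclideanSpace.single m 1))) := by
    refine (DFunLike.congr_fun h1 _).trans ?_
    simp [cubeParamLinear_single]
  rw [h3, norm_mul, norm_mul, Complex.norm_real, Complex.norm_real, mul_pow, mul_pow,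
    norm_eq_abs, norm_eq_abs, sq_abs, sq_abs]
  ring

end NeumannCube

/-- **Theorem (Neumann Lieb–Thirring inequality on a cube, orthonormal case).** For every
`d ≥ 1` there is a `C_d' > 0` such that for every cube `Q ⊂ ℝ^d`, every `N ≥ 1` and all
smooth `φ₁,…,φ_N : ℝ^d → ℂ` whose restrictions to `Q` are orthonormal in `L²(Q)`,
`∑_j ∫_Q |∇φ_j|² ≥ C_d' ∫_Q [ρ^{1/2} − |Q|^{-1/2}]₊^{2(d+2)/d}`,
where `ρ := ∑_j |φ_j|²`. -/
theorem neumann_lieb_thirring_cube_orthonormal (d : ℕ) (hd : 1 ≤ d) :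
    ∃ C : ℝ, 0 < C ∧
      ∀ Q : Set (EuclideanSpace ℝ (Fin d)), IsCube d Q →
      ∀ N : ℕ, 1 ≤ N →
      ∀ φ : Fin N → EuclideanSpace ℝ (Fin d) → ℂ, (∀ j, ContDiff ℝ (⊤ : ℕ∞) (φ j)) →
      (∀ j k : Fin N, (∫ x in Q, φ j x * starRingEnd ℂ (φ k x)) =
        if j = k then 1 else 0) →
      ENNReal.ofReal (C * ∫ x in Q, (max (Real.sqrt (∑ j : Fin N, ‖φ j x‖ ^ 2) -
            (Real.sqrt (volume Q).toReal)⁻¹) 0) ^ (2 * ((d : ℝ) + 2) / (d : ℝ))) ≤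
        ∑ j : Fin N, ∫⁻ x in Q, ENNReal.ofReal
          (∑ m : Fin d, ‖fderiv ℝ (φ j) x (EuclideanSpace.single m (1 : ℝ))‖ ^ 2) := by
  open NeumannCube in
  refine ⟨1 / 9 * (1 / 2) ^ (2 * ((d : ℝ) + 2) / d), by positivity, ?_⟩
  rintro Q ⟨L, hL, f, rfl⟩ N - φ hφ' ho
  have hφ (j : Fin N) : ContDiff ℝ 1 (φ j) := (hφ' j).of_le (by exact_mod_cast le_top)
  have hd0 : (0 : ℝ) < d := by exact_mod_cast hd
  set C : ℝ := 1 / 9 * (1 / 2) ^ (2 * ((d : ℝ) + 2) / d) with hC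
  have hC0 : 0 < C := by positivity
  set p := 2 * ((d : ℝ) + 2) / d with hp
  have hp0 : 0 < p := by positivity
  set V := L ^ d with hV
  have hV0 : 0 < V := by positivity
  have hem := measurableEmbedding_cubeParam f hL
  have hvol : (volume (f '' {x : EuclideanSpace ℝ (Fin d) | ∀ m, x m ∈ Set.Ioo 0 L})).toReal =
      V := by
    rw [← Measure.restrict_apply_univ, restrict_image_eq_map_cubeParam f hL, Measure.smul_apply,
      hem.map_apply]
    simp [hV0.le, ← hV]
  rw [hvol]
  have hlint (F : EuclideanSpace ℝ (Fin d) → ENNReal) :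
      ∫⁻ x in f '' {x : EuclideanSpace ℝ (Fin d) | ∀ m, x m ∈ Set.Ioo 0 L}, F x =
        ENNReal.ofReal V * ∫⁻ y, F (cubeParam f L y) ∂cubeMeasure d := by
    rw [restrict_image_eq_map_cubeParam f hL, lintegral_smul_measure, hem.lintegral_map,
      smul_eq_mul]
  have hintegral (F : EuclideanSpace ℝ (Fin d) → ℂ) :
      ∫ x in f '' {x : EuclideanSpace ℝ (Fin d) | ∀ m, x m ∈ Set.Ioo 0 L}, F x =
        (V : ℂ) * ∫ y, F (cubeParam f L y) ∂cubeMeasure d := by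
    rw [restrict_image_eq_map_cubeParam f hL, integral_smul_measure, hem.integral_map,
      ENNReal.toReal_ofReal hV0.le, Complex.real_smul]
  set h : EuclideanSpace ℝ (Fin d) → ℝ := fun x =>
    max (Real.sqrt (∑ j : Fin N, ‖φ j x‖ ^ 2) - (Real.sqrt V)⁻¹) 0 ^ p with hh
  set ψ : Fin N → (Fin d → ℝ) → ℂ := fun j y => (Real.sqrt V : ℂ) * φ j (cubeParam f L y) with hψ
  have hψc (j : Fin N) : ContDiff ℝ 1 (ψ j) :=
    contDiff_const.mul ((hφ j).comp (contDiff_cubeParam f))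
  have hψo : Orthonormal ℂ fun j => toL2 (ψ j) (hψc j).continuous := by
    rw [orthonormal_iff_ite]
    intro j k
    have h1 (y : Fin d → ℝ) : ψ k y * starRingEnd ℂ (ψ j y) =
        (V : ℂ) * (φ k (cubeParam f L y) * starRingEnd ℂ (φ j (cubeParam f L y))) := by
      have h2 : (Real.sqrt V : ℂ) * Real.sqrt V = V := by
        rw [← Complex.ofReal_mul, Real.mul_self_sqrt hV0.le]
      rw [hψ, ← h2]
      simp only [map_mul, Complex.conj_ofReal]
      ring
    rw [inner_toL2, integral_congr_ae (.of_forall h1), integral_const_mul,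
      ← hintegral fun x => φ k x * starRingEnd ℂ (φ j x), ho k j]
    simp only [eq_comm]
  have hscale (y : Fin d → ℝ) : C * max (Real.sqrt (∑ j, ‖ψ j y‖ ^ 2) - 1) 0 ^ p =
      L ^ 2 * (V * (C * h (cubeParam f L y))) := by
    have h1 : ∑ j, ‖ψ j y‖ ^ 2 = V * ∑ j, ‖φ j (cubeParam f L y)‖ ^ 2 := by
      rw [Finset.mul_sum]
      refine Finset.sum_congr rfl fun j _ => ?_
      rw [hψ, norm_mul, mul_pow, Complex.norm_real, Real.norm_eq_abs, sq_abs,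
        Real.sq_sqrt hV0.le]
    have h2 : max (Real.sqrt (∑ j, ‖ψ j y‖ ^ 2) - 1) 0 = Real.sqrt V *
        max (Real.sqrt (∑ j, ‖φ j (cubeParam f L y)‖ ^ 2) - (Real.sqrt V)⁻¹) 0 := by
      rw [h1, Real.sqrt_mul hV0.le, mul_max_of_nonneg _ _ (Real.sqrt_nonneg V), mul_sub,
        mul_inv_cancel₀ (Real.sqrt_pos.2 hV0).ne', mul_zero]
    have h3 : Real.sqrt V ^ p = L ^ 2 * V := by
      rw [Real.sqrt_eq_rpow, hV, ← Real.rpow_natCast, ← Real.rpow_mul hL.le,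
        ← Real.rpow_mul hL.le, ← Real.rpow_natCast, ← Real.rpow_add hL]
      congr 1
      rw [hp]
      field_simp
      push_cast
      ring
    rw [h2, Real.mul_rpow (Real.sqrt_nonneg V) (le_max_right _ _), h3, hh]
    ring
  have hgrad (j : Fin N) (y : Fin d → ℝ) := sum_norm_sq_fderiv_comp_cubeParam f (L := L) (hφ j)
    (Real.sqrt V) y
  have hhc : Continuous h := by
    refine Continuous.rpow_const (by fun_prop) fun x => Or.inr hp0.le
  have hh0 (x) : 0 ≤ h x := Real.rpow_nonneg (le_max_right _ _) _
  have hunit : ∫⁻ y, ENNReal.ofReal (C * max (Real.sqrt (∑ j, ‖ψ j y‖ ^ 2) - 1) 0 ^ p)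
      ∂cubeMeasure d ≤ ∑ j, ∫⁻ y, ENNReal.ofReal
        (∑ m, ‖fderiv ℝ (ψ j) y (Pi.single m 1)‖ ^ 2) ∂cubeMeasure d :=
    neumann_lieb_thirring_unit_cube hd hψc hψo
  simp only [hscale] at hunit
  simp only [hψ, hgrad, Real.sq_sqrt hV0.le] at hunit
  have hL2 : 0 ≤ L ^ 2 := sq_nonneg L
  have hpull (G : (Fin d → ℝ) → ℝ) :
      ∫⁻ y, ENNReal.ofReal (L ^ 2 * (V * G y)) ∂cubeMeasure d =
        ENNReal.ofReal (L ^ 2) * (ENNReal.ofReal V * ∫⁻ y, ENNReal.ofReal (G y) ∂cubeMeasure d) := by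
    simp only [ENNReal.ofReal_mul hL2, ENNReal.ofReal_mul hV0.le]
    rw [lintegral_const_mul' _ _ ENNReal.ofReal_ne_top,
      lintegral_const_mul' _ _ ENNReal.ofReal_ne_top]
  simp only [mul_comm V (L ^ 2), mul_assoc, hpull] at hunit
  rw [← Finset.mul_sum, ENNReal.mul_le_mul_iff_right
    (ENNReal.ofReal_pos.2 (by positivity)).ne' ENNReal.ofReal_ne_top] at hunit
  simp only [hlint]
  refine le_trans ?_ hunit
  rw [← hlint fun x => ENNReal.ofReal (C * h x), ← integral_const_mul,
    integral_eq_lintegral_of_nonneg_ae (.of_forall fun x => mul_nonneg hC0.le (hh0 x))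
      (continuous_const.mul hhc).aestronglyMeasurable]
  exact ENNReal.ofReal_toReal_le

end
end
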